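/- arXiv:1204.4938 — 9 statements merged into one kernel-verified Lean document; each statement's English description precedes it below -/
import Mathlib

section
/- For every integer k ≥ 1, the conditional probability that k lies in R_∞ + R_∞ given that k−1 lies in R_∞ + R_∞ equals 2 + (F_{k+2} + (−1)^k·3^⌊k/2⌋ − 2^{k+1}) / (2·(2^k − 3^⌊k/2⌋)), where F_j denotes the j-th Fibonacci number (F_1 = F_2 = 1). -/
open Finset Filter

open Classical in
/-- The number of missing sums of `R` in the integer interval `[a, b]`, i.e.
`#{k ∈ ℤ ∩ [a,b] : k ∉ R + R}` where `R + R = {x + y : x, y ∈ R}`. -/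
noncomputable def missSum (R : Finset ℕ) (a b : ℤ) : ℕ :=
  ((Finset.Icc a b).filter (fun k => ¬ ∃ x ∈ R, ∃ y ∈ R, (x : ℤ) + (y : ℤ) = k)).card

open Classical in
/-- The number of missing differences of `R` in the integer interval `[a, b]`, i.e.
`#{k ∈ ℤ ∩ [a,b] : k ∉ R - R}` where `R - R = {x - y : x, y ∈ R}`. -/
noncomputable def missDiff (R : Finset ℕ) (a b : ℤ) : ℕ :=
  ((Finset.Icc a b).filter (fun k => ¬ ∃ x ∈ R, ∃ y ∈ R, (x : ℤ) - (y : ℤ) = k)).card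

open Classical in
/-- The probability that the random set `R_n` — a subset of `{0,…,n-1}` in which each
element is included independently with probability `1/2`, i.e. a uniformly random
subset of `{0,…,n-1}` — satisfies the event `p`. -/
noncomputable def pR (n : ℕ) (p : Finset ℕ → Prop) : ℝ :=
  (((Finset.range n).powerset.filter p).card : ℝ) / 2 ^ n

open Classical in
/-- The probability that the random set `R_n'` — a uniformly random subset of
`{0,…,n-1}` conditioned on containing `0` — satisfies the event `p`. -/
noncomputable def pR' (n : ℕ) (p : Finset ℕ → Prop) : ℝ :=
  (((Finset.range n).powerset.filter (fun S => 0 ∈ S ∧ p S)).card : ℝ) / 2 ^ (n - 1)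

open Classical in
/-- The probability that the random set `R_n''` — a uniformly random subset of
`{0,…,n-1}` conditioned on containing both `0` and `n-1` — satisfies the event `p`. -/
noncomputable def pR'' (n : ℕ) (p : Finset ℕ → Prop) : ℝ :=
  (((Finset.range n).powerset.filter (fun S => 0 ∈ S ∧ n - 1 ∈ S ∧ p S)).card : ℝ) / 2 ^ (n - 2)

open Classical in
/-- The probability that the random set `R_∞` — a subset of `ℕ` in which each
nonnegative integer is included independently with probability `1/2` — satisfies the
event `p`, for an event `p` depending only on the elements `< N` of the set.  Since
each of the `2^N` possibilities for `R_∞ ∩ {0,…,N-1}` is equally likely and `p` is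
determined by this intersection, the probability is obtained by counting. -/
noncomputable def probInf (N : ℕ) (p : Finset ℕ → Prop) : ℝ :=
  (((Finset.range N).powerset.filter p).card : ℝ) / 2 ^ N

/-- `k` is not in `S + S`. -/
def MissesSum (k : ℕ) (S : Finset ℕ) : Prop := ∀ x ∈ S, ∀ y ∈ S, x + y ≠ k

lemma not_exists_add_eq_iff (k : ℕ) (S : Finset ℕ) :
    (¬ ∃ x ∈ S, ∃ y ∈ S, x + y = k) ↔ MissesSum k S := by
  simp [MissesSum]

lemma missesSum_empty (k : ℕ) : MissesSum k ∅ := by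
  simp [MissesSum]

lemma missesSum_insert (k a : ℕ) (S : Finset ℕ) :
    MissesSum k (insert a S) ↔ a + a ≠ k ∧ (∀ x ∈ S, a + x ≠ k) ∧ MissesSum k S := by
  simp only [MissesSum, Finset.forall_mem_insert]
  constructor
  · rintro ⟨⟨h₁, h₂⟩, h₃⟩
    exact ⟨h₁, h₂, fun x hx => (h₃ x hx).2⟩
  · rintro ⟨h₁, h₂, h₃⟩
    exact ⟨⟨h₁, h₂⟩, fun x hx => ⟨by rw [add_comm]; exact h₂ x hx, h₃ x hx⟩⟩

lemma missesSum_image_succ (k : ℕ) (S : Finset ℕ) :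
    MissesSum (k + 2) (S.image Nat.succ) ↔ MissesSum k S := by
  simp only [MissesSum, Finset.forall_mem_image]
  refine forall₂_congr fun x _ => forall₂_congr fun y _ => ?_
  simp only [Nat.succ_eq_add_one]
  omega

open Classical in
/-- The number of subsets of `{0, …, n - 1}` satisfying `p`. -/
noncomputable def subsetCount (n : ℕ) (p : Finset ℕ → Prop) : ℕ :=
  ((Finset.range n).powerset.filter p).card

lemma subsetCount_congr {n : ℕ} {p q : Finset ℕ → Prop}
    (h : ∀ S, (∀ x ∈ S, x < n) → (p S ↔ q S)) : subsetCount n p = subsetCount n q := by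
  classical
  unfold subsetCount
  congr 1
  refine Finset.filter_congr fun S hS => h S fun x hx => ?_
  exact Finset.mem_range.1 (Finset.mem_powerset.1 hS hx)

lemma subsetCount_eq_zero {n : ℕ} {p : Finset ℕ → Prop} (h : ∀ S, ¬ p S) :
    subsetCount n p = 0 := by
  simp [subsetCount, h]

lemma subsetCount_zero {p : Finset ℕ → Prop} (h : p ∅) : subsetCount 0 p = 1 := by
  simp [subsetCount, Finset.filter_singleton, h]

lemma card_filter_powerset_insert {α : Type*} [DecidableEq α] {a : α} {s : Finset α}
    (ha : a ∉ s) (p : Finset α → Prop) [DecidablePred p] :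
    ((insert a s).powerset.filter p).card =
      (s.powerset.filter p).card + (s.powerset.filter fun S => p (insert a S)).card := by
  rw [Finset.powerset_insert, Finset.filter_union, Finset.card_union_of_disjoint]
  · congr 1
    rw [Finset.filter_image, Finset.card_image_of_injOn]
    intro S hS T hT h
    simp only [Finset.coe_filter, Finset.mem_powerset, Set.mem_ofPred_eq] at hS hT
    rw [← Finset.erase_insert (fun h => ha (hS.1 h)), ← Finset.erase_insert (fun h => ha (hT.1 h))]
    exact congrArg (fun U : Finset α => U.erase a) h
  · rw [Finset.disjoint_left]
    intro S hS hS'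
    simp only [Finset.mem_filter, Finset.mem_powerset, Finset.mem_image] at hS hS'
    obtain ⟨⟨T, _, rfl⟩, _⟩ := hS'
    exact ha (hS.1 (Finset.mem_insert_self a T))

/-- Split according to whether the largest possible element is present. -/
lemma subsetCount_succ_last (n : ℕ) (p : Finset ℕ → Prop) :
    subsetCount (n + 1) p = subsetCount n p + subsetCount n (fun S => p (insert n S)) := by
  classical
  unfold subsetCount
  rw [Finset.range_add_one]
  convert card_filter_powerset_insert Finset.notMem_range_self p

/-- Split according to whether `0` is present, shifting the other elements down. -/
lemma subsetCount_succ_first (n : ℕ) (p : Finset ℕ → Prop) :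
    subsetCount (n + 1) p = subsetCount n (fun S => p (S.image Nat.succ)) +
      subsetCount n (fun S => p (insert 0 (S.image Nat.succ))) := by
  induction n generalizing p with
  | zero =>
    rw [subsetCount_succ_last]
    congr 1
  | succ n ih =>
    rw [subsetCount_succ_last, ih, ih, subsetCount_succ_last n, subsetCount_succ_last n]
    simp only [Finset.image_insert, Nat.succ_eq_add_one, Finset.insert_comm (n + 1) 0]
    ring

lemma subsetCount_add_not (n : ℕ) (p : Finset ℕ → Prop) :
    subsetCount n p + subsetCount n (fun S => ¬ p S) = 2 ^ n := by
  classical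
  unfold subsetCount
  have h := Finset.card_filter_add_card_filter_not (s := (Finset.range n).powerset) p
  rw [Finset.card_powerset, Finset.card_range] at h
  convert h

lemma subsetCount_and_add (n : ℕ) (p q : Finset ℕ → Prop) :
    subsetCount n (fun S => p S ∧ q S) + subsetCount n (fun S => p S ∧ ¬ q S) =
      subsetCount n p := by
  classical
  unfold subsetCount
  have h := Finset.card_filter_add_card_filter_not
    (s := (Finset.range n).powerset.filter p) q
  rw [Finset.filter_filter, Finset.filter_filter] at h
  convert h

lemma subsetCount_missesSum (k : ℕ) : subsetCount (k + 1) (MissesSum k) = 3 ^ ((k + 1) / 2) := by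
  induction k using Nat.twoStepInduction with
  | zero =>
    rw [subsetCount_succ_last, subsetCount_zero (missesSum_empty 0)]
    simp [subsetCount_eq_zero, MissesSum]
  | one =>
    rw [subsetCount_succ_last, subsetCount_succ_last, subsetCount_zero (missesSum_empty 1)]
    simp [subsetCount_succ_last, subsetCount_zero, subsetCount_eq_zero, MissesSum]
  | more k ih _ =>
    have h_zero : subsetCount (k + 1) (fun S => MissesSum (k + 2) (insert 0 (S.image Nat.succ))) =
        subsetCount (k + 1) (MissesSum k) := by
      refine subsetCount_congr fun S hS => ?_
      rw [missesSum_insert, missesSum_image_succ, Finset.forall_mem_image]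
      exact ⟨fun h => h.2.2, fun h => ⟨by omega, fun x hx => by have := hS x hx; omega, h⟩⟩
    have h_last : subsetCount (k + 1)
        (fun S => MissesSum (k + 2) (insert (k + 2) (S.image Nat.succ))) =
        subsetCount (k + 1) (MissesSum k) := by
      refine subsetCount_congr fun S _ => ?_
      rw [missesSum_insert, missesSum_image_succ, Finset.forall_mem_image]
      exact ⟨fun h => h.2.2, fun h => ⟨by omega, fun x _ => by omega, h⟩⟩
    have h_both : subsetCount (k + 1)
        (fun S => MissesSum (k + 2) (insert (k + 2) (insert 0 (S.image Nat.succ)))) = 0 := by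
      refine subsetCount_eq_zero fun S h => ?_
      exact h (k + 2) (by simp) 0 (by simp) rfl
    rw [subsetCount_succ_last, subsetCount_succ_first, subsetCount_succ_first (k + 1), h_zero,
      h_last, h_both, subsetCount_congr fun S _ => missesSum_image_succ k S, ih,
      show (k + 2 + 1) / 2 = (k + 1) / 2 + 1 by omega]
    ring

lemma subsetCount_missesSum_succ (k : ℕ) :
    subsetCount (k + 2) (MissesSum k) = 2 * 3 ^ ((k + 1) / 2) := by
  rw [subsetCount_succ_last, subsetCount_congr (p := fun S => MissesSum k (insert (k + 1) S))
    (q := MissesSum k), subsetCount_missesSum, two_mul]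
  intro S _
  rw [missesSum_insert]
  exact ⟨fun h => h.2.2, fun h => ⟨by omega, fun x _ => by omega, h⟩⟩

lemma subsetCount_missesSum_pair (k : ℕ) :
    subsetCount (k + 1) (fun S => MissesSum k S ∧ MissesSum (k + 1) S) = Nat.fib (k + 2) ∧
    subsetCount (k + 2) (fun S => MissesSum k S ∧ MissesSum (k + 1) S) = Nat.fib (k + 3) := by
  induction k using Nat.twoStepInduction with
  | zero =>
    constructor <;> simp [subsetCount_succ_last, subsetCount_zero, subsetCount_eq_zero, MissesSum, Nat.fib]
  | one =>
    constructor <;> simp [subsetCount_succ_last, subsetCount_zero, subsetCount_eq_zero, MissesSum, Nat.fib]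
  | more k ih _ =>
    have h_shift : subsetCount (k + 2)
        (fun S => MissesSum (k + 2) (S.image Nat.succ) ∧ MissesSum (k + 3) (S.image Nat.succ)) =
        subsetCount (k + 2) (fun S => MissesSum k S ∧ MissesSum (k + 1) S) :=
      subsetCount_congr fun S _ =>
        and_congr (missesSum_image_succ k S) (missesSum_image_succ (k + 1) S)
    have h_zero : subsetCount (k + 1) (fun S => MissesSum (k + 2) (insert 0 (S.image Nat.succ)) ∧
          MissesSum (k + 3) (insert 0 (S.image Nat.succ))) =
        subsetCount (k + 1) (fun S => MissesSum k S ∧ MissesSum (k + 1) S) := by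
      refine subsetCount_congr fun S hS => ?_
      rw [missesSum_insert, missesSum_insert, missesSum_image_succ,
        missesSum_image_succ (k + 1), Finset.forall_mem_image, Finset.forall_mem_image]
      refine ⟨fun h => ⟨h.1.2.2, h.2.2.2⟩, fun h => ⟨⟨by omega, fun x hx => ?_, h.1⟩,
        by omega, fun x hx => ?_, h.2⟩⟩ <;>
      · have := hS x hx
        omega
    have h_zero_last : subsetCount (k + 1)
        (fun S => MissesSum (k + 2) (insert 0 ((insert (k + 1) S).image Nat.succ)) ∧
          MissesSum (k + 3) (insert 0 ((insert (k + 1) S).image Nat.succ))) = 0 :=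
      subsetCount_eq_zero fun S h => h.1 (k + 2) (by simp) 0 (by simp) rfl
    have h_last : subsetCount (k + 2)
        (fun S => MissesSum (k + 2) (insert (k + 3) (S.image Nat.succ)) ∧
          MissesSum (k + 3) (insert (k + 3) (S.image Nat.succ))) =
        subsetCount (k + 2) (fun S => MissesSum k S ∧ MissesSum (k + 1) S) := by
      refine subsetCount_congr fun S _ => ?_
      rw [missesSum_insert, missesSum_insert, missesSum_image_succ,
        missesSum_image_succ (k + 1), Finset.forall_mem_image, Finset.forall_mem_image]
      exact ⟨fun h => ⟨h.1.2.2, h.2.2.2⟩, fun h => ⟨⟨by omega, fun x _ => by omega, h.1⟩,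
        by omega, fun x _ => by omega, h.2⟩⟩
    have h_last_zero : subsetCount (k + 2)
        (fun S => MissesSum (k + 2) (insert (k + 3) (insert 0 (S.image Nat.succ))) ∧
          MissesSum (k + 3) (insert (k + 3) (insert 0 (S.image Nat.succ)))) = 0 :=
      subsetCount_eq_zero fun S h => h.2 (k + 3) (by simp) 0 (by simp) rfl
    have h_small : subsetCount (k + 3) (fun S => MissesSum (k + 2) S ∧ MissesSum (k + 3) S) =
        Nat.fib (k + 4) := by
      rw [subsetCount_succ_first, h_shift, ih.2, subsetCount_succ_last, h_zero,
        h_zero_last, ih.1, Nat.fib_add_two (n := k + 2)]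
      ring
    refine ⟨h_small, ?_⟩
    rw [subsetCount_succ_last, h_small, subsetCount_succ_first, h_last, h_last_zero, ih.2,
      Nat.fib_add_two (n := k + 3)]
    ring

lemma three_pow_half_lt_two_pow {k : ℕ} (hk : 1 ≤ k) : 3 ^ (k / 2) < 2 ^ k := by
  rcases Nat.lt_or_ge k 2 with h | h
  · obtain rfl : k = 1 := by omega
    norm_num
  · calc 3 ^ (k / 2) < 4 ^ (k / 2) := Nat.pow_lt_pow_left (by norm_num) (by omega)
      _ = 2 ^ (2 * (k / 2)) := by rw [pow_mul]; norm_num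
      _ ≤ 2 ^ k := Nat.pow_le_pow_right (by norm_num) (by omega)

/-- For every integer `k ≥ 1`, the conditional probability that
`k ∈ R_∞ + R_∞` given that `k - 1 ∈ R_∞ + R_∞` equals
`2 + (F_{k+2} + (-1)^k 3^⌊k/2⌋ - 2^{k+1}) / (2 (2^k - 3^⌊k/2⌋))`.
(Both events depend only on the elements `≤ k` of `R_∞`.) -/
theorem cond_prob_consecutive_sums (k : ℕ) (hk : 1 ≤ k) :
    probInf (k + 1) (fun S => (∃ x ∈ S, ∃ y ∈ S, x + y = k) ∧ (∃ x ∈ S, ∃ y ∈ S, x + y = k - 1)) /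
      probInf (k + 1) (fun S => ∃ x ∈ S, ∃ y ∈ S, x + y = k - 1) =
    2 + ((Nat.fib (k + 2) : ℝ) + (-1) ^ k * 3 ^ (k / 2) - 2 ^ (k + 1)) /
      (2 * ((2 : ℝ) ^ k - 3 ^ (k / 2))) := by
  obtain ⟨j, rfl⟩ : ∃ j, k = j + 1 := ⟨k - 1, by omega⟩
  simp only [Nat.add_sub_cancel]
  set p : Finset ℕ → Prop := fun S => ∃ x ∈ S, ∃ y ∈ S, x + y = j + 1
  set q : Finset ℕ → Prop := fun S => ∃ x ∈ S, ∃ y ∈ S, x + y = j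
  have hp : ∀ S, ¬ p S ↔ MissesSum (j + 1) S := not_exists_add_eq_iff (j + 1)
  have hq : ∀ S, ¬ q S ↔ MissesSum j S := not_exists_add_eq_iff j
  have e₁ := subsetCount_add_not (j + 1 + 1) q
  have e₂ := subsetCount_add_not (j + 1 + 1) p
  have e₃ := subsetCount_and_add (j + 1 + 1) p q
  have e₄ := subsetCount_and_add (j + 1 + 1) (fun S => ¬ q S) p
  rw [subsetCount_congr (p := fun S => ¬ q S ∧ p S) (q := fun S => p S ∧ ¬ q S)
    (fun S _ => and_comm)] at e₄
  simp only [hp, hq] at e₁ e₂ e₃ e₄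
  rw [subsetCount_missesSum_succ] at e₁ e₄
  rw [subsetCount_missesSum] at e₂
  rw [(subsetCount_missesSum_pair j).2] at e₄
  have hlt := three_pow_half_lt_two_pow hk
  have hpos : (0 : ℝ) < 2 ^ (j + 1) - 3 ^ ((j + 1) / 2) := by
    rw [sub_pos]
    exact_mod_cast hlt
  have hprob : ∀ r : Finset ℕ → Prop,
      probInf (j + 1 + 1) r = (subsetCount (j + 1 + 1) r : ℝ) / 2 ^ (j + 1 + 1) := fun _ => rfl
  rw [hprob, hprob, div_div_div_cancel_right₀ (by positivity)]
  have f₁ : (subsetCount (j + 1 + 1) q : ℝ) = 2 * (2 ^ (j + 1) - 3 ^ ((j + 1) / 2)) := by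
    have := congrArg (Nat.cast (R := ℝ)) e₁
    push_cast at this
    rw [pow_succ (2 : ℝ) (j + 1)] at this
    linarith
  have f₂ : (subsetCount (j + 1 + 1) (fun S => p S ∧ q S) : ℝ) =
      2 ^ (j + 1 + 1) - 3 ^ ((j + 1 + 1) / 2) - 2 * 3 ^ ((j + 1) / 2) + Nat.fib (j + 3) := by
    have g₂ := congrArg (Nat.cast (R := ℝ)) e₂
    have g₃ := congrArg (Nat.cast (R := ℝ)) e₃
    have g₄ := congrArg (Nat.cast (R := ℝ)) e₄
    push_cast at g₂ g₃ g₄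
    linarith
  have f₃ : (3 : ℝ) ^ ((j + 1 + 1) / 2) = (2 - (-1) ^ (j + 1)) * 3 ^ ((j + 1) / 2) := by
    rcases Nat.even_or_odd (j + 1) with h | h
    · rw [h.neg_one_pow, show (j + 1 + 1) / 2 = (j + 1) / 2 by grind]
      ring
    · rw [h.neg_one_pow, show (j + 1 + 1) / 2 = (j + 1) / 2 + 1 by grind]
      ring
  rw [f₁, f₂, f₃]
  field_simp
  ring
end

section
/- For every integer k ≥ 3, the probability that both k−1 and k lie in R_∞ + R_∞ equals 1 + F_{k+2}/2^{k+1} − 3^⌊k/2⌋·(4 − (−1)^k)/2^{k+1}, where F_j denotes the j-th Fibonacci number (F_1 = F_2 = 1). -/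
open Finset Filter

/-- The set `S` contains no two (possibly equal) `r`-related elements. -/
def IsIndepFor (r : ℕ → ℕ → Prop) (S : Finset ℕ) : Prop :=
  ∀ x ∈ S, ∀ y ∈ S, ¬ r x y

open Classical in
/-- The number of subsets of `V` that contain no two (possibly equal) `r`-related elements. -/
noncomputable def indepCount (V : Finset ℕ) (r : ℕ → ℕ → Prop) : ℕ :=
  (V.powerset.filter (IsIndepFor r)).card

theorem indepCount_empty (r : ℕ → ℕ → Prop) : indepCount ∅ r = 1 := by
  simp [indepCount, IsIndepFor, Finset.filter_singleton]

open Classical in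
theorem indepCount_insert {V : Finset ℕ} {r : ℕ → ℕ → Prop} {a : ℕ} (ha : a ∉ V) :
    indepCount (insert a V) r = indepCount V r +
      (V.powerset.filter (fun S => IsIndepFor r (insert a S))).card := by
  unfold indepCount
  rw [Finset.powerset_insert, Finset.filter_union, Finset.card_union_of_disjoint]
  · congr 1
    rw [Finset.filter_image, Finset.card_image_of_injOn]
    intro S hS T hT hST
    simp only [Finset.coe_filter, Finset.mem_powerset, Set.mem_ofPred_eq] at hS hT
    have hS' : a ∉ S := fun h => ha (hS.1 h)
    have hT' : a ∉ T := fun h => ha (hT.1 h)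
    simpa [Finset.erase_insert hS', Finset.erase_insert hT'] using
      congrArg (fun U => Finset.erase U a) hST
  · refine Finset.disjoint_filter_filter ?_
    rw [Finset.disjoint_left]
    intro S hS hS'
    obtain ⟨T, -, rfl⟩ := Finset.mem_image.1 hS'
    exact ha (Finset.mem_powerset.1 hS (Finset.mem_insert_self a T))

theorem indepCount_insert_of_rel {V : Finset ℕ} {r : ℕ → ℕ → Prop} {a : ℕ} (ha : a ∉ V)
    (haa : r a a) : indepCount (insert a V) r = indepCount V r := by
  classical
  rw [indepCount_insert ha, Finset.filter_eq_empty_iff.2]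
  · simp
  · intro S _ h
    exact h a (Finset.mem_insert_self a S) a (Finset.mem_insert_self a S) haa

/-- Deletion–contraction at a loopless vertex `a` whose non-neighbours in `V` form `W`. -/
theorem indepCount_insert_of_not_rel {V W : Finset ℕ} {r : ℕ → ℕ → Prop} {a : ℕ} (ha : a ∉ V)
    (hr : ∀ x y, r x y → r y x) (haa : ¬ r a a) (hW : ∀ x, x ∈ W ↔ x ∈ V ∧ ¬ r a x) :
    indepCount (insert a V) r = indepCount V r + indepCount W r := by
  classical
  rw [indepCount_insert ha]
  congr 1
  unfold indepCount
  congr 1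
  ext S
  simp only [IsIndepFor, Finset.mem_filter, Finset.mem_powerset, Finset.forall_mem_insert]
  constructor
  · rintro ⟨hS, ⟨-, h1⟩, h2⟩
    exact ⟨fun x hx => (hW x).2 ⟨hS hx, h1 x hx⟩, fun x hx => (h2 x hx).2⟩
  · rintro ⟨hS, h⟩
    have h1 : ∀ x ∈ S, ¬ r a x := fun x hx => ((hW x).1 (hS hx)).2
    exact ⟨fun x hx => ((hW x).1 (hS hx)).1, ⟨haa, h1⟩,
      fun x hx => ⟨fun hxa => h1 x hx (hr x a hxa), h x hx⟩⟩

theorem indepCount_sum_eq (t : ℕ) : ∀ n a : ℕ, 2 * a + n = t + 1 →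
    indepCount (Finset.Ico a (a + n)) (fun x y => x + y = t) = 3 ^ (n / 2)
  | 0, a, _ => by simp [indepCount_empty]
  | 1, a, h => by
    have : Finset.Ico a (a + 1) = insert a ∅ := by simp
    rw [this, indepCount_insert_of_rel (by simp) (by omega), indepCount_empty]
    simp
  | n + 2, a, h => by
    have ih := indepCount_sum_eq t n (a + 1) (by omega)
    have e1 : Finset.Ico a (a + (n + 2)) = insert (a + n + 1) (Finset.Ico a (a + n + 1)) := by
      ext x; simp only [Finset.mem_insert, Finset.mem_Ico]; omega
    have e2 : Finset.Ico a (a + n + 1) = insert a (Finset.Ico (a + 1) (a + 1 + n)) := by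
      ext x; simp only [Finset.mem_insert, Finset.mem_Ico]; omega
    rw [e1, indepCount_insert_of_not_rel (W := Finset.Ico (a + 1) (a + 1 + n)) (by simp)
        (by intros; omega) (by omega) (by intro x; simp only [Finset.mem_Ico]; omega), e2,
      indepCount_insert_of_not_rel (W := Finset.Ico (a + 1) (a + 1 + n)) (by simp)
        (by intros; omega) (by omega) (by intro x; simp only [Finset.mem_Ico]; omega), ih,
      show (n + 2) / 2 = n / 2 + 1 by omega]
    ring

theorem indepCount_consecutive_sums (t : ℕ) : ∀ n a : ℕ, 2 * a + n = t + 1 ∨ 2 * a + n = t + 2 →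
    indepCount (Finset.Ico a (a + n)) (fun x y => x + y = t ∨ x + y = t + 1) = Nat.fib (n + 1)
  | 0, a, _ => by simp [indepCount_empty]
  | 1, a, h => by
    have : Finset.Ico a (a + 1) = insert a ∅ := by simp
    rw [this, indepCount_insert_of_rel (by simp) (by omega), indepCount_empty]
    simp
  | n + 2, a, h => by
    have ih := indepCount_consecutive_sums t n (a + 1) (by omega)
    rw [Nat.fib_add_two (n := n + 1), add_comm (Nat.fib (n + 1))]
    rcases h with h | h
    · have ih' := indepCount_consecutive_sums t (n + 1) (a + 1) (by omega)
      have e : Finset.Ico a (a + (n + 2)) = insert a (Finset.Ico (a + 1) (a + 1 + (n + 1))) := by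
        ext x; simp only [Finset.mem_insert, Finset.mem_Ico]; omega
      rw [e, indepCount_insert_of_not_rel (W := Finset.Ico (a + 1) (a + 1 + n)) (by simp)
        (by intros; omega) (by omega) (by intro x; simp only [Finset.mem_Ico]; omega), ih, ih']
    · have ih' := indepCount_consecutive_sums t (n + 1) a (by omega)
      have e : Finset.Ico a (a + (n + 2)) = insert (a + (n + 1)) (Finset.Ico a (a + (n + 1))) := by
        ext x; simp only [Finset.mem_insert, Finset.mem_Ico]; omega
      rw [e, indepCount_insert_of_not_rel (W := Finset.Ico (a + 1) (a + 1 + n)) (by simp)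
        (by intros; omega) (by omega) (by intro x; simp only [Finset.mem_Ico]; omega), ih, ih']

open Classical in
/-- Inclusion–exclusion for the sets having both an `r`-related and an `s`-related pair. -/
theorem card_rel_and_rel_add (V : Finset ℕ) (r s : ℕ → ℕ → Prop) :
    (V.powerset.filter (fun S => ¬ IsIndepFor r S ∧ ¬ IsIndepFor s S)).card +
      (indepCount V r + indepCount V s) =
    2 ^ V.card + indepCount V (fun x y => r x y ∨ s x y) := by
  have h : ∀ S, IsIndepFor (fun x y => r x y ∨ s x y) S ↔ IsIndepFor r S ∧ IsIndepFor s S := by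
    intro S
    simp only [IsIndepFor, not_or, forall_and]
  simp only [indepCount, h]
  rw [← Finset.card_union_add_card_inter, ← Finset.filter_or, ← Finset.filter_and, ← add_assoc,
    ← Finset.card_powerset, ← Finset.card_filter_add_card_filter_not (s := V.powerset)
      (fun S => ¬ IsIndepFor r S ∧ ¬ IsIndepFor s S)]
  simp only [not_and_or, not_not]

theorem indepCount_range_succ_pred (k : ℕ) (hk : 1 ≤ k) :
    indepCount (Finset.range (k + 1)) (fun x y => x + y = k - 1) = 2 * 3 ^ (k / 2) := by
  have h := indepCount_sum_eq (k - 1) k 0 (by omega)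
  rw [zero_add, ← Finset.range_eq_Ico] at h
  rw [Finset.range_add_one, indepCount_insert_of_not_rel (W := Finset.range k) (by simp)
    (by intros; omega) (by omega) (by intro x; simp only [Finset.mem_range]; omega), h]
  ring

/-- For every integer `k ≥ 3`, the probability that both `k - 1` and `k`
lie in `R_∞ + R_∞` equals `1 + F_{k+2}/2^{k+1} - 3^⌊k/2⌋ (4 - (-1)^k)/2^{k+1}`.
(The event depends only on the elements `≤ k` of `R_∞`.) -/
theorem prob_consecutive_sums (k : ℕ) (hk : 3 ≤ k) :
    probInf (k + 1) (fun S => (∃ x ∈ S, ∃ y ∈ S, x + y = k - 1) ∧ (∃ x ∈ S, ∃ y ∈ S, x + y = k)) =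
    1 + (Nat.fib (k + 2) : ℝ) / 2 ^ (k + 1) -
      3 ^ (k / 2) * (4 - (-1 : ℝ) ^ k) / 2 ^ (k + 1) := by
  have hA := indepCount_range_succ_pred k (by omega)
  have hB := indepCount_sum_eq k (k + 1) 0 (by omega)
  have hC := indepCount_consecutive_sums (k - 1) (k + 1) 0 (by omega)
  rw [zero_add, ← Finset.range_eq_Ico] at hB hC
  rw [Nat.sub_add_cancel (by omega : 1 ≤ k)] at hC
  classical
  have h := card_rel_and_rel_add (Finset.range (k + 1)) (fun x y => x + y = k - 1)
    (fun x y => x + y = k)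
  rw [hA, hB, hC, Finset.card_range] at h
  have h' := congrArg (Nat.cast : ℕ → ℝ) h
  push_cast at h'
  have key : (2 : ℝ) * 3 ^ (k / 2) + 3 ^ ((k + 1) / 2) = 3 ^ (k / 2) * (4 - (-1 : ℝ) ^ k) := by
    rcases Nat.even_or_odd k with hk' | hk'
    · rw [hk'.neg_one_pow, show (k + 1) / 2 = k / 2 by obtain ⟨m, rfl⟩ := hk'; omega]
      ring
    · rw [hk'.neg_one_pow, show (k + 1) / 2 = k / 2 + 1 by obtain ⟨m, rfl⟩ := hk'; omega]
      ring
  rw [key] at h'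
  unfold probInf
  rw [← eq_sub_iff_add_eq] at h'
  have h2 : (2 : ℝ) ^ (k + 1) ≠ 0 := by positivity
  have e : ∀ S : Finset ℕ, ((∃ x ∈ S, ∃ y ∈ S, x + y = k - 1) ∧ (∃ x ∈ S, ∃ y ∈ S, x + y = k)) ↔
      ¬ IsIndepFor (fun x y => x + y = k - 1) S ∧ ¬ IsIndepFor (fun x y => x + y = k) S := by
    intro S
    simp [IsIndepFor]
  simp only [e]
  rw [h']
  field_simp
end

section
/- For every nonnegative integer k, the probability that k lies in R_∞ + R_∞ equals 1 − (3/4)^{(k+1)/2} if k is odd, and equals 1 − (1/2)·(3/4)^{k/2} if k is even. -/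
open Finset Filter

/-- `S` contains no two elements, equal or distinct, whose sum is `n - 1`. -/
def IsSumAvoiding (n : ℕ) (S : Finset ℕ) : Prop :=
  ∀ x ∈ S, ∀ y ∈ S, x + y + 1 ≠ n

open Classical in
/-- Adjoining to `T` two complementary elements, neither of them complementary to an element
of `T`, triples the number of sum-avoiding subsets. -/
theorem card_filter_powerset_insert_insert {n a b : ℕ} {T : Finset ℕ} (hab : a ≠ b)
    (hn : a + b + 1 = n) (ha : a ∉ T) (hb : b ∉ T) :
    ((insert a (insert b T)).powerset.filter (IsSumAvoiding n)).card =
      3 * (T.powerset.filter (IsSumAvoiding n)).card := by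
  have insert_iff {a b : ℕ} (hab : a ≠ b) (hn : a + b + 1 = n) (hb : b ∉ T) {S : Finset ℕ}
      (hS : S ⊆ T) : IsSumAvoiding n (insert a S) ↔ IsSumAvoiding n S := by
    refine ⟨fun h x hx y hy => h x (mem_insert_of_mem hx) y (mem_insert_of_mem hy),
      fun h x hx y hy hxy => ?_⟩
    have hbS : b ∉ S := fun h => hb (hS h)
    rcases mem_insert.mp hx with hxa | hxS <;> rcases mem_insert.mp hy with hya | hyS
    · omega
    · exact hbS ((show y = b by omega) ▸ hyS)
    · exact hbS ((show x = b by omega) ▸ hxS)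
    · exact h x hxS y hyS hxy
  have hboth (S : Finset ℕ) : ¬ IsSumAvoiding n (insert a (insert b S)) := fun h =>
    h a (by simp) b (by simp) hn
  simp only [card_filter]
  rw [sum_powerset_insert (by simp [hab, ha]), sum_powerset_insert hb, sum_powerset_insert hb]
  simp only [hboth, if_false, sum_const_zero]
  rw [sum_congr rfl fun S hS => if_congr
      (insert_iff hab.symm (by omega) ha (mem_powerset.mp hS)) rfl rfl,
    sum_congr rfl fun S hS => if_congr (insert_iff hab hn hb (mem_powerset.mp hS)) rfl rfl]
  ring

open Classical in
theorem card_filter_powerset_Ico_isSumAvoiding (c n : ℕ) :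
    ((Ico c (c + n)).powerset.filter (IsSumAvoiding (2 * c + n))).card = 3 ^ (n / 2) := by
  induction n using Nat.twoStepInduction generalizing c with
  | zero => simp [IsSumAvoiding, filter_singleton]
  | one =>
    have h : (Ico c (c + 1)).powerset.filter (IsSumAvoiding (2 * c + 1)) = {∅} := by
      ext S
      simp only [Nat.Ico_succ_singleton, mem_filter, mem_powerset, subset_singleton_iff,
        mem_singleton]
      constructor
      · rintro ⟨rfl | rfl, h⟩
        · rfl
        · exact absurd (by omega) (h c (by simp) c (by simp))
      · rintro rfl
        simp [IsSumAvoiding]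
    rw [h, card_singleton, Nat.div_eq_of_lt one_lt_two, pow_zero]
  | more n ih _ =>
    have hIco : Ico c (c + (n + 2)) =
        insert c (insert (c + n + 1) (Ico (c + 1) (c + 1 + n))) := by
      ext x
      simp only [mem_insert, mem_Ico]
      omega
    rw [hIco, card_filter_powerset_insert_insert (by omega) (by omega) (by simp)
      (by simp only [mem_Ico]; omega), show 2 * c + (n + 2) = 2 * (c + 1) + n by ring, ih,
      Nat.add_div_right _ two_pos, pow_succ']

/-- For every nonnegative integer `k`, the probability that
`k ∈ R_∞ + R_∞` equals `1 - (3/4)^{(k+1)/2}` if `k` is odd and `1 - (1/2)(3/4)^{k/2}`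
if `k` is even.  (The event depends only on the elements `≤ k` of `R_∞`.) -/
theorem prob_mem_sumset (k : ℕ) :
    probInf (k + 1) (fun S => ∃ x ∈ S, ∃ y ∈ S, x + y = k) =
    if Odd k then 1 - (3 / 4 : ℝ) ^ ((k + 1) / 2) else 1 - (1 / 2) * (3 / 4 : ℝ) ^ (k / 2) := by
  classical
  have hcount := card_filter_powerset_Ico_isSumAvoiding 0 (k + 1)
  have hadd := card_filter_add_card_filter_not
    (s := (range (k + 1)).powerset) (fun S => ∃ x ∈ S, ∃ y ∈ S, x + y = k)
  have hnot : (range (k + 1)).powerset.filter (fun S => ¬ ∃ x ∈ S, ∃ y ∈ S, x + y = k) =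
      (Ico 0 (0 + (k + 1))).powerset.filter (IsSumAvoiding (2 * 0 + (k + 1))) := by
    rw [zero_add, ← range_eq_Ico]
    refine filter_congr fun S _ => ?_
    simp [IsSumAvoiding]
  rw [hnot, hcount, card_powerset, card_range] at hadd
  have hcast : (((range (k + 1)).powerset.filter
      (fun S => ∃ x ∈ S, ∃ y ∈ S, x + y = k)).card : ℝ) = 2 ^ (k + 1) - 3 ^ ((k + 1) / 2) := by
    rw [eq_sub_iff_add_eq]
    exact_mod_cast hadd
  have hprob : probInf (k + 1) (fun S => ∃ x ∈ S, ∃ y ∈ S, x + y = k) =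
      (2 ^ (k + 1) - 3 ^ ((k + 1) / 2)) / 2 ^ (k + 1) := by
    rw [← hcast, probInf]
    congr!
  rw [hprob, sub_div, div_self (by positivity)]
  split_ifs with hk
  · obtain ⟨m, rfl⟩ := hk
    rw [show 2 * m + 1 + 1 = 2 * (m + 1) by ring, Nat.mul_div_cancel_left _ two_pos, pow_mul,
      div_pow]
    norm_num
  · obtain ⟨m, rfl⟩ := (Nat.not_odd_iff_even.mp hk).two_dvd
    rw [show (2 * m + 1) / 2 = m by omega, Nat.mul_div_cancel_left _ two_pos, pow_succ, pow_mul,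
      div_pow]
    norm_num
    ring
end

section
/- For every nonnegative integer m, lim_{n→∞} P(f⁺_{[0,2n−2]}(R_n) = m) = Σ_{i=0}^{m} [lim_{n→∞} P(f⁺_{[0,n−1]}(R_n) = i)] · [lim_{n→∞} P(f⁺_{[0,n−1]}(R_n) = m−i)], where all the indicated limits exist. -/
open Finset Filter

open Classical in
/-- The probability that a uniformly random subset of the finite set `A` satisfies `p`. -/
noncomputable def subsetProb (A : Finset ℕ) (p : Finset ℕ → Prop) : ℝ :=
  ((A.powerset.filter p).card : ℝ) / 2 ^ A.card

theorem pR_eq_subsetProb (n : ℕ) (p : Finset ℕ → Prop) : pR n p = subsetProb (range n) p := by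
  simp [pR, subsetProb]

section SubsetProb

variable {A B C : Finset ℕ} {p q : Finset ℕ → Prop}

theorem subsetProb_eq_card_div (A : Finset ℕ) (p : Finset ℕ → Prop) [DecidablePred p] :
    subsetProb A p = ((A.powerset.filter p).card : ℝ) / 2 ^ A.card := by
  unfold subsetProb
  congr!

theorem subsetProb_congr (h : ∀ S ⊆ A, (p S ↔ q S)) : subsetProb A p = subsetProb A q := by
  classical
  unfold subsetProb
  congr 3
  exact filter_congr fun S hS => h S (mem_powerset.1 hS)

theorem subsetProb_mono (h : ∀ S ⊆ A, p S → q S) : subsetProb A p ≤ subsetProb A q := by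
  classical
  unfold subsetProb
  gcongr 1
  refine Nat.cast_le.2 (card_le_card fun S hS => ?_)
  rw [mem_filter] at hS ⊢
  exact ⟨hS.1, h S (mem_powerset.1 hS.1) hS.2⟩

theorem subsetProb_true : subsetProb A (fun _ => True) = 1 := by
  simp [subsetProb]

theorem subsetProb_false : subsetProb A (fun _ => False) = 0 := by
  simp [subsetProb]

theorem subsetProb_or_le :
    subsetProb A (fun S => p S ∨ q S) ≤ subsetProb A p + subsetProb A q := by
  classical
  simp only [subsetProb_eq_card_div]
  rw [← add_div]
  gcongr 1
  rw [filter_or]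
  exact_mod_cast card_union_le _ _

theorem subsetProb_exists_le {ι : Type*} (T : Finset ι) (p : ι → Finset ℕ → Prop) :
    subsetProb A (fun S => ∃ i ∈ T, p i S) ≤ ∑ i ∈ T, subsetProb A (p i) := by
  classical
  induction T using Finset.induction_on with
  | empty => simp [subsetProb_false]
  | insert a T ha ih =>
    rw [sum_insert ha]
    simp only [exists_mem_insert]
    exact subsetProb_or_le.trans (by gcongr)

theorem abs_subsetProb_sub_le {e : Finset ℕ → Prop} (h : ∀ S ⊆ A, ¬ e S → (p S ↔ q S)) :
    |subsetProb A p - subsetProb A q| ≤ subsetProb A e := by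
  have hp : subsetProb A p ≤ subsetProb A q + subsetProb A e :=
    (subsetProb_mono fun S hS hp => by have := h S hS; tauto).trans subsetProb_or_le
  have hq : subsetProb A q ≤ subsetProb A p + subsetProb A e :=
    (subsetProb_mono fun S hS hq => by have := h S hS; tauto).trans subsetProb_or_le
  rw [abs_le]
  constructor <;> linarith

theorem subsetProb_add_eq (X Y : Finset ℕ → ℕ) (m : ℕ) :
    subsetProb A (fun S => X S + Y S = m) =
      ∑ i ∈ range (m + 1), subsetProb A (fun S => X S = i ∧ Y S = m - i) := by
  classical
  simp only [subsetProb_eq_card_div]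
  rw [← sum_div, ← Nat.cast_sum,
    card_eq_sum_card_fiberwise (f := X) (t := range (m + 1))
      (fun S hS => by
        have := (mem_filter.1 (mem_coe.1 hS)).2
        simp only [coe_range, Set.mem_Iio]
        omega)]
  congr 2
  refine sum_congr rfl fun i hi => ?_
  rw [filter_filter]
  congr 1
  refine filter_congr fun S _ => ?_
  have := mem_range.1 hi
  omega

/-- Events determined by disjoint parts of the ground set are independent. -/
theorem subsetProb_union_and (h : Disjoint A B) :
    subsetProb (A ∪ B) (fun S => p (S ∩ A) ∧ q (S ∩ B)) = subsetProb A p * subsetProb B q := by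
  classical
  unfold subsetProb
  rw [card_union_of_disjoint h, pow_add, div_mul_div_comm, ← Nat.cast_mul, ← card_product]
  congr 2
  refine card_bij' (fun S _ => (S ∩ A, S ∩ B)) (fun T _ => T.1 ∪ T.2) ?_ ?_ ?_ ?_
  · intro S hS
    simp only [mem_filter, mem_product, mem_powerset] at hS ⊢
    exact ⟨⟨inter_subset_right, hS.2.1⟩, inter_subset_right, hS.2.2⟩
  · rintro ⟨T, U⟩ hT
    simp only [mem_filter, mem_product, mem_powerset] at hT ⊢
    obtain ⟨⟨hT, hp⟩, hU, hq⟩ := hT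
    rw [union_inter_distrib_right, union_inter_distrib_right, inter_eq_left.2 hT,
      inter_eq_left.2 hU, disjoint_iff_inter_eq_empty.1 (h.symm.mono_left hU),
      disjoint_iff_inter_eq_empty.1 (h.mono_left hT), union_empty, empty_union]
    exact ⟨union_subset_union hT hU, hp, hq⟩
  · intro S hS
    simp only [mem_filter, mem_powerset] at hS
    rw [← inter_union_distrib_left, inter_eq_left.2 hS.1]
  · rintro ⟨T, U⟩ hT
    simp only [mem_filter, mem_product, mem_powerset] at hT
    obtain ⟨⟨hT, hp⟩, hU, hq⟩ := hT
    dsimp only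
    rw [union_inter_distrib_right, union_inter_distrib_right, inter_eq_left.2 hT,
      inter_eq_left.2 hU, disjoint_iff_inter_eq_empty.1 (h.symm.mono_left hU),
      disjoint_iff_inter_eq_empty.1 (h.mono_left hT), union_empty, empty_union]

theorem subsetProb_inter (h : A ⊆ C) :
    subsetProb C (fun S => p (S ∩ A)) = subsetProb A p := by
  have := subsetProb_union_and (p := p) (q := fun _ => True) (disjoint_sdiff (s := A) (t := C))
  rwa [union_sdiff_of_subset h, subsetProb_true, mul_one,
    subsetProb_congr (q := fun S => p (S ∩ A)) (by simp)] at this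

theorem subsetProb_inter_and (h : Disjoint A B) (hA : A ⊆ C) (hB : B ⊆ C) :
    subsetProb C (fun S => p (S ∩ A) ∧ q (S ∩ B)) = subsetProb A p * subsetProb B q := by
  rw [← subsetProb_union_and h, ← subsetProb_inter (union_subset hA hB)]
  refine subsetProb_congr fun S _ => ?_
  rw [inter_assoc, inter_assoc, inter_eq_right.2 subset_union_left,
    inter_eq_right.2 subset_union_right]

theorem subsetProb_image {f : ℕ → ℕ} (hf : Set.InjOn f A) :
    subsetProb (A.image f) p = subsetProb A (fun S => p (S.image f)) := by
  classical
  unfold subsetProb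
  rw [card_image_of_injOn hf]
  congr 2
  symm
  refine card_bij (fun S _ => S.image f) ?_ ?_ ?_
  · intro S hS
    simp only [mem_filter, mem_powerset] at hS ⊢
    exact ⟨image_subset_image hS.1, hS.2⟩
  · intro S hS T hT hST
    simp only [mem_filter, mem_powerset] at hS hT
    have h := congrArg (fun U : Finset ℕ => (U : Set ℕ)) hST
    simp only [coe_image] at h
    exact_mod_cast (hf.image_eq_image_iff (coe_subset.2 hS.1) (coe_subset.2 hT.1)).1 h
  · intro T hT
    simp only [mem_filter, mem_powerset] at hT
    obtain ⟨S, hS, rfl⟩ := subset_image_iff.1 hT.1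
    exact ⟨S, by simpa using ⟨hS, hT.2⟩, rfl⟩

theorem subsetProb_pair_not_subset {a b : ℕ} (h : a ≠ b) :
    subsetProb {a, b} (fun S => ¬ (a ∈ S ∧ b ∈ S)) = 3 / 4 := by
  classical
  have hcard : (({a, b} : Finset ℕ).powerset.filter fun S => ¬ (a ∈ S ∧ b ∈ S)) =
      ({a, b} : Finset ℕ).powerset.erase {a, b} := by
    ext S
    simp only [mem_filter, mem_powerset, mem_erase]
    refine ⟨fun hS => ⟨?_, hS.1⟩, fun hS => ⟨hS.2, fun hab => hS.1 ?_⟩⟩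
    · rintro rfl
      simp at hS
    · refine hS.2.antisymm ?_
      simpa [insert_subset_iff] using hab
  rw [subsetProb_eq_card_div, hcard, card_erase_of_mem (by simp), card_powerset, card_pair h]
  norm_num

end SubsetProb

/-- `k` is not a sum of two elements of `S`. -/
def IsMissingSum (S : Finset ℕ) (k : ℕ) : Prop :=
  ¬ ∃ x ∈ S, ∃ y ∈ S, x + y = k

open Classical in
/-- The number of missing sums of `S` among `0, …, N - 1`. -/
noncomputable def missingBelow (N : ℕ) (S : Finset ℕ) : ℕ :=
  ((range N).filter (IsMissingSum S)).card

theorem missSum_eq_missingBelow (S : Finset ℕ) (N : ℕ) (b : ℤ) (hb : b + 1 = N) :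
    missSum S 0 b = missingBelow N S := by
  classical
  unfold missSum missingBelow
  symm
  refine card_bij (fun k _ => (k : ℤ)) ?_ ?_ ?_
  · intro k hk
    simp only [mem_filter, mem_range, mem_Icc, IsMissingSum] at hk ⊢
    refine ⟨by omega, ?_⟩
    exact_mod_cast hk.2
  · intro k _ l _ h
    exact_mod_cast h
  · intro k hk
    simp only [mem_filter, mem_Icc] at hk
    lift k to ℕ using hk.1.1
    refine ⟨k, ?_, rfl⟩
    simp only [mem_filter, mem_range, IsMissingSum]
    refine ⟨by omega, ?_⟩
    exact_mod_cast hk.2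

theorem isMissingSum_inter {S A : Finset ℕ} {k : ℕ} (h : range (k + 1) ⊆ A) :
    IsMissingSum (S ∩ A) k ↔ IsMissingSum S k := by
  unfold IsMissingSum
  refine not_congr ⟨?_, ?_⟩
  · rintro ⟨x, hx, y, hy, hxy⟩
    exact ⟨x, (mem_inter.1 hx).1, y, (mem_inter.1 hy).1, hxy⟩
  · rintro ⟨x, hx, y, hy, hxy⟩
    exact ⟨x, mem_inter.2 ⟨hx, h (mem_range.2 (by omega))⟩, y,
      mem_inter.2 ⟨hy, h (mem_range.2 (by omega))⟩, hxy⟩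

theorem missingBelow_inter_range (S : Finset ℕ) (K : ℕ) :
    missingBelow K (S ∩ range K) = missingBelow K S := by
  classical
  unfold missingBelow
  congr 1
  refine filter_congr fun k hk => isMissingSum_inter ?_
  exact range_mono (mem_range.1 hk)

theorem exists_isMissingSum_of_missingBelow_ne {K N : ℕ} {S : Finset ℕ} (hKN : K ≤ N)
    (h : missingBelow N S ≠ missingBelow K S) : ∃ k ∈ Ico K N, IsMissingSum S k := by
  classical
  contrapose! h
  unfold missingBelow
  congr 1
  ext k
  simp only [mem_filter, mem_range]
  refine ⟨fun hk => ⟨?_, hk.2⟩, fun hk => ⟨by omega, hk.2⟩⟩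
  by_contra hkK
  exact h k (mem_Ico.2 ⟨by omega, hk.1⟩) hk.2

theorem subsetProb_no_complementary_pair {k j : ℕ} (h : 2 * j ≤ k + 1) :
    subsetProb (range j ∪ Ioc (k - j) k) (fun S => ∀ x < j, ¬ (x ∈ S ∧ k - x ∈ S)) =
      (3 / 4) ^ j := by
  induction j with
  | zero => simp [subsetProb_true]
  | succ j ih =>
    have hdisj : Disjoint (range j ∪ Ioc (k - j) k) {j, k - j} := by
      rw [disjoint_right]
      simp only [mem_insert, mem_singleton, mem_union, mem_range, mem_Ioc]
      omega
    have hunion : range (j + 1) ∪ Ioc (k - (j + 1)) k =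
        (range j ∪ Ioc (k - j) k) ∪ {j, k - j} := by
      ext x
      simp only [mem_insert, mem_singleton, mem_union, mem_range, mem_Ioc]
      omega
    rw [pow_succ, ← ih (by omega), ← subsetProb_pair_not_subset (a := j) (b := k - j) (by omega),
      ← subsetProb_union_and hdisj, hunion]
    refine subsetProb_congr fun S _ => ?_
    have hleft : (∀ x < j, ¬ (x ∈ S ∩ (range j ∪ Ioc (k - j) k) ∧
        k - x ∈ S ∩ (range j ∪ Ioc (k - j) k))) ↔ ∀ x < j, ¬ (x ∈ S ∧ k - x ∈ S) := by
      refine forall₂_congr fun x hx => not_congr ?_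
      simp only [mem_inter, mem_union, mem_range, mem_Ioc]
      have : k - j < k - x ∧ k - x ≤ k := by omega
      tauto
    rw [hleft]
    simp only [Nat.lt_succ_iff_lt_or_eq, mem_inter, mem_insert, mem_singleton, true_or, or_true,
      and_true]
    refine ⟨fun H => ⟨fun x hx => H x (.inl hx), H j (.inr rfl)⟩, ?_⟩
    rintro ⟨H, H'⟩ x (hx | rfl)
    exacts [H x hx, H']

theorem subsetProb_isMissingSum_le {n k : ℕ} (hk : k < n) :
    subsetProb (range n) (fun S => IsMissingSum S k) ≤ (7 / 8 : ℝ) ^ k := by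
  obtain ⟨j, hj, hkj⟩ : ∃ j, 2 * j ≤ k + 1 ∧ k ≤ 2 * j := ⟨(k + 1) / 2, by omega, by omega⟩
  have hsub : range j ∪ Ioc (k - j) k ⊆ range n := by
    intro x
    simp only [mem_union, mem_range, mem_Ioc]
    omega
  calc subsetProb (range n) (fun S => IsMissingSum S k)
      ≤ subsetProb (range n) (fun S => ∀ x < j, ¬ (x ∈ S ∩ (range j ∪ Ioc (k - j) k) ∧
          k - x ∈ S ∩ (range j ∪ Ioc (k - j) k))) :=
        subsetProb_mono fun S _ hS x hx hxS =>
          hS ⟨x, (mem_inter.1 hxS.1).1, k - x, (mem_inter.1 hxS.2).1, by omega⟩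
    _ = (3 / 4) ^ j := (subsetProb_inter (p := fun S => ∀ x < j, ¬ (x ∈ S ∧ k - x ∈ S))
          hsub).trans (subsetProb_no_complementary_pair hj)
    _ ≤ ((7 / 8) ^ 2) ^ j := by gcongr; norm_num
    _ = (7 / 8) ^ (2 * j) := (pow_mul _ _ _).symm
    _ ≤ (7 / 8) ^ k := pow_le_pow_of_le_one (by norm_num) (by norm_num) hkj

theorem subsetProb_missingBelow_ne_le {n N K : ℕ} (hKN : K ≤ N) (hNn : N ≤ n) :
    subsetProb (range n) (fun S => missingBelow N S ≠ missingBelow K S) ≤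
      8 * (7 / 8 : ℝ) ^ K :=
  calc _ ≤ subsetProb (range n) (fun S => ∃ k ∈ Ico K N, IsMissingSum S k) :=
        subsetProb_mono fun _ _ h => exists_isMissingSum_of_missingBelow_ne hKN h
    _ ≤ ∑ k ∈ Ico K N, subsetProb (range n) (fun S => IsMissingSum S k) :=
        subsetProb_exists_le _ _
    _ ≤ ∑ k ∈ Ico K N, (7 / 8 : ℝ) ^ k := sum_le_sum fun k hk =>
        subsetProb_isMissingSum_le ((mem_Ico.1 hk).2.trans_le hNn)
    _ ≤ (7 / 8 : ℝ) ^ K / (1 - 7 / 8) :=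
        geom_sum_Ico_le_of_lt_one (by norm_num) (by norm_num)
    _ = 8 * (7 / 8 : ℝ) ^ K := by ring

theorem subsetProb_missingBelow_eq_of_le {K n : ℕ} (h : K ≤ n) (i : ℕ) :
    subsetProb (range n) (fun S => missingBelow K S = i) =
      subsetProb (range K) (fun S => missingBelow K S = i) := by
  rw [← subsetProb_inter (range_mono h)]
  simp only [missingBelow_inter_range]

theorem abs_subsetProb_missingBelow_sub_le {K n : ℕ} (h : K ≤ n) (i : ℕ) :
    |subsetProb (range n) (fun S => missingBelow n S = i) -
      subsetProb (range K) (fun S => missingBelow K S = i)| ≤ 8 * (7 / 8 : ℝ) ^ K := by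
  rw [← subsetProb_missingBelow_eq_of_le h]
  refine (abs_subsetProb_sub_le fun S _ hS => ?_).trans (subsetProb_missingBelow_ne_le h le_rfl)
  rw [not_not.1 hS]

theorem tendsto_tail_bound : Tendsto (fun K : ℕ => 8 * (7 / 8 : ℝ) ^ K) atTop (nhds 0) := by
  simpa using (tendsto_pow_atTop_nhds_zero_of_lt_one (r := (7 / 8 : ℝ)) (by norm_num)
    (by norm_num)).const_mul 8

theorem exists_tendsto_subsetProb_missingBelow (i : ℕ) :
    ∃ l : ℝ, Tendsto (fun n => subsetProb (range n) (fun S => missingBelow n S = i))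
      atTop (nhds l) := by
  refine cauchySeq_tendsto_of_complete (cauchySeq_of_le_tendsto_0' _ (fun K n h => ?_)
    tendsto_tail_bound)
  rw [dist_comm, Real.dist_eq]
  exact abs_subsetProb_missingBelow_sub_le h i

/-- The image of `S` under the reflection `x ↦ n - 1 - x`. -/
def reflectBelow (n : ℕ) (S : Finset ℕ) : Finset ℕ :=
  S.image (fun x => n - 1 - x)

theorem mem_reflectBelow {n x : ℕ} {S : Finset ℕ} (hS : S ⊆ range n) :
    x ∈ reflectBelow n S ↔ x < n ∧ n - 1 - x ∈ S := by
  simp only [reflectBelow, mem_image]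
  constructor
  · rintro ⟨y, hy, rfl⟩
    have := mem_range.1 (hS hy)
    refine ⟨by omega, ?_⟩
    rwa [show n - 1 - (n - 1 - y) = y by omega]
  · rintro ⟨hx, h⟩
    exact ⟨_, h, by omega⟩

theorem injOn_reflection (n : ℕ) : Set.InjOn (fun x => n - 1 - x) (range n : Set ℕ) := by
  intro x hx y hy h
  have hx := mem_range.1 (mem_coe.1 hx)
  have hy := mem_range.1 (mem_coe.1 hy)
  dsimp only at h
  omega

theorem reflectBelow_Ico {n K : ℕ} (h : K ≤ n) : reflectBelow n (Ico (n - K) n) = range K := by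
  ext x
  rw [mem_reflectBelow (fun y hy => mem_range.2 (mem_Ico.1 hy).2), mem_Ico, mem_range]
  omega

theorem subsetProb_Ico_reflectBelow {n K : ℕ} (h : K ≤ n) (p : Finset ℕ → Prop) :
    subsetProb (Ico (n - K) n) (fun S => p (reflectBelow n S)) = subsetProb (range K) p := by
  rw [← reflectBelow_Ico h]
  refine (subsetProb_image ((injOn_reflection n).mono fun x hx => ?_)).symm
  exact mem_coe.2 (mem_range.2 (mem_Ico.1 (mem_coe.1 hx)).2)

theorem subsetProb_range_reflectBelow (n : ℕ) (p : Finset ℕ → Prop) :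
    subsetProb (range n) (fun S => p (reflectBelow n S)) = subsetProb (range n) p := by
  have h := subsetProb_Ico_reflectBelow (le_refl n) p
  rwa [Nat.sub_self, ← range_eq_Ico] at h

theorem reflectBelow_inter_Ico {n K : ℕ} {S : Finset ℕ} (h : K ≤ n) (hS : S ⊆ range n) :
    reflectBelow n (S ∩ Ico (n - K) n) = reflectBelow n S ∩ range K := by
  ext x
  rw [mem_reflectBelow (inter_subset_left.trans hS), mem_inter, mem_inter, mem_reflectBelow hS,
    mem_Ico, mem_range]
  have : x < n → ((n - K ≤ n - 1 - x ∧ n - 1 - x < n) ↔ x < K) := by omega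
  tauto

theorem isMissingSum_reflectBelow {n k l : ℕ} {S : Finset ℕ} (hS : S ⊆ range n)
    (hkl : k + l + 2 = 2 * n) : IsMissingSum (reflectBelow n S) k ↔ IsMissingSum S l := by
  unfold IsMissingSum
  refine not_congr ⟨?_, ?_⟩
  · rintro ⟨x, hx, y, hy, hxy⟩
    rw [mem_reflectBelow hS] at hx hy
    exact ⟨_, hx.2, _, hy.2, by omega⟩
  · rintro ⟨x, hx, y, hy, hxy⟩
    have hxn := mem_range.1 (hS hx)
    have hyn := mem_range.1 (hS hy)
    exact ⟨_, mem_image_of_mem _ hx, _, mem_image_of_mem _ hy, by omega⟩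

/-- The missing sums at or above `n` correspond to missing sums of the reflected set below
`n - 1`. -/
theorem missingBelow_eq_add_reflectBelow {n : ℕ} {S : Finset ℕ} (hS : S ⊆ range n) :
    missingBelow (n + (n - 1)) S =
      missingBelow n S + missingBelow (n - 1) (reflectBelow n S) := by
  classical
  simp only [missingBelow, card_filter]
  rw [sum_range_add, ← sum_range_reflect _ (n - 1)]
  congr 1
  refine sum_congr rfl fun j hj => ?_
  have := mem_range.1 hj
  simp only [isMissingSum_reflectBelow (k := j) (l := n + (n - 1 - 1 - j)) hS (by omega)]

theorem subsetProb_missingBelow_add_reflectBelow {n K : ℕ} (h : 2 * K ≤ n) (m : ℕ) :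
    subsetProb (range n)
        (fun S => missingBelow K S + missingBelow K (reflectBelow n S) = m) =
      ∑ i ∈ range (m + 1), subsetProb (range K) (fun S => missingBelow K S = i) *
        subsetProb (range K) (fun S => missingBelow K S = m - i) := by
  rw [subsetProb_add_eq]
  refine sum_congr rfl fun i _ => ?_
  have hdisj : Disjoint (range K) (Ico (n - K) n) := by
    rw [disjoint_left]
    simp only [mem_range, mem_Ico]
    omega
  rw [← subsetProb_Ico_reflectBelow (n := n) (by omega) (fun S => missingBelow K S = m - i),
    ← subsetProb_inter_and hdisj (range_mono (by omega))
      (fun x hx => mem_range.2 (mem_Ico.1 hx).2)]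
  refine subsetProb_congr fun S hS => ?_
  rw [missingBelow_inter_range, reflectBelow_inter_Ico (by omega) hS, missingBelow_inter_range]

theorem abs_subsetProb_missingBelow_total_sub_le {n K : ℕ} (h : 2 * K ≤ n) (hn : 0 < n) (m : ℕ) :
    |subsetProb (range n) (fun S => missingBelow (n + (n - 1)) S = m) -
      ∑ i ∈ range (m + 1), subsetProb (range K) (fun S => missingBelow K S = i) *
        subsetProb (range K) (fun S => missingBelow K S = m - i)| ≤
      2 * (8 * (7 / 8 : ℝ) ^ K) := by
  rw [← subsetProb_missingBelow_add_reflectBelow h, two_mul]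
  calc _ ≤ subsetProb (range n) (fun S => missingBelow n S ≠ missingBelow K S ∨
        missingBelow (n - 1) (reflectBelow n S) ≠ missingBelow K (reflectBelow n S)) := by
        refine abs_subsetProb_sub_le fun S hS hne => ?_
        rw [not_or, not_not, not_not] at hne
        rw [missingBelow_eq_add_reflectBelow hS, hne.1, hne.2]
    _ ≤ _ := subsetProb_or_le
    _ ≤ _ := by
        rw [subsetProb_range_reflectBelow n
          (fun S => missingBelow (n - 1) S ≠ missingBelow K S)]
        exact add_le_add (subsetProb_missingBelow_ne_le (by omega) le_rfl)
          (subsetProb_missingBelow_ne_le (by omega) (by omega))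

/-- For every nonnegative integer `m`,
`lim_{n→∞} P(f⁺_{[0,2n-2]}(R_n) = m) = Σ_{i=0}^m lim P(f⁺_{[0,n-1]}(R_n) = i) · lim P(f⁺_{[0,n-1]}(R_n) = m-i)`,
where all the indicated limits exist. -/
theorem missing_sums_all_eq_convolution (m : ℕ) :
    ∃ L : ℕ → ℝ,
      (∀ i ≤ m, Tendsto (fun n : ℕ => pR n (fun S => missSum S 0 ((n : ℤ) - 1) = i))
        atTop (nhds (L i))) ∧
      Tendsto (fun n : ℕ => pR n (fun S => missSum S 0 (2 * (n : ℤ) - 2) = m)) atTop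
        (nhds (∑ i ∈ Finset.range (m + 1), L i * L (m - i))) := by
  choose L hL using exists_tendsto_subsetProb_missingBelow
  refine ⟨L, fun i _ => ?_, ?_⟩
  · simp only [pR_eq_subsetProb]
    refine (hL i).congr fun n => subsetProb_congr fun S _ => ?_
    rw [missSum_eq_missingBelow S n _ (by ring)]
  · have hlim : Tendsto (fun K => ∑ i ∈ range (m + 1),
        subsetProb (range K) (fun S => missingBelow K S = i) *
          subsetProb (range K) (fun S => missingBelow K S = m - i)) atTop
        (nhds (∑ i ∈ range (m + 1), L i * L (m - i))) :=
      tendsto_finsetSum _ fun i _ => (hL i).mul (hL (m - i))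
    have hhalf : Tendsto (fun n : ℕ => n / 2) atTop atTop :=
      Nat.tendsto_div_const_atTop two_ne_zero
    have herr := (tendsto_tail_bound.comp hhalf).const_mul 2
    rw [mul_zero] at herr
    have hdiff := squeeze_zero_norm' (f := fun n =>
      subsetProb (range n) (fun S => missingBelow (n + (n - 1)) S = m) -
        ∑ i ∈ range (m + 1),
          subsetProb (range (n / 2)) (fun S => missingBelow (n / 2) S = i) *
            subsetProb (range (n / 2)) (fun S => missingBelow (n / 2) S = m - i))
      ((eventually_gt_atTop 0).mono fun n hn =>
        abs_subsetProb_missingBelow_total_sub_le (by omega) hn m) herr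
    have htotal := hdiff.add (hlim.comp hhalf)
    rw [zero_add] at htotal
    refine htotal.congr' ((eventually_gt_atTop 0).mono fun n hn => ?_)
    simp only [Function.comp_apply, sub_add_cancel, pR_eq_subsetProb]
    refine subsetProb_congr fun S _ => ?_
    rw [missSum_eq_missingBelow S (n + (n - 1)) _ (by omega)]
end

section
/- For every nonnegative integer m, lim_{n→∞} P(f⁺_{[0,n−1]}(R_n) = m) = Σ_{i=0}^{⌊m/2⌋} (1/2^{i+1}) · lim_{n→∞} P(f⁺_{[0,n−1]}(R_n') = m−2i), where all the indicated limits exist. -/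
open Finset Filter

theorem missSum_insert_self (S : Finset ℕ) (n : ℕ) :
    missSum (insert n S) 0 ((n : ℤ) - 1) = missSum S 0 ((n : ℤ) - 1) := by
  unfold missSum
  congr 1
  refine Finset.filter_congr fun k hk => not_congr ⟨?_, ?_⟩
  · rintro ⟨x, hx, y, hy, h⟩
    rw [Finset.mem_Icc] at hk
    rw [Finset.mem_insert] at hx hy
    have hxn : x ≠ n := by omega
    have hyn : y ≠ n := by omega
    exact ⟨x, hx.resolve_left hxn, y, hy.resolve_left hyn, h⟩
  · rintro ⟨x, hx, y, hy, h⟩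
    exact ⟨x, Finset.mem_insert_of_mem hx, y, Finset.mem_insert_of_mem hy, h⟩

theorem missSum_mono_right (S : Finset ℕ) {a b c : ℤ} (h : b ≤ c) :
    missSum S a b ≤ missSum S a c :=
  Finset.card_le_card (Finset.filter_subset_filter _ (Finset.Icc_subset_Icc le_rfl h))

/-- Shifting a set by one adds the missing sums `0` and `1`. -/
theorem missSum_image_succ (T : Finset ℕ) (n : ℕ) :
    missSum (T.image Nat.succ) 0 ((n + 2 : ℕ) - 1 : ℤ) = missSum T 0 ((n : ℤ) - 1) + 2 := by
  classical
  let B := (Finset.Icc (0 : ℤ) ((n : ℤ) - 1)).filter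
    (fun k => ¬ ∃ x ∈ T, ∃ y ∈ T, (x : ℤ) + (y : ℤ) = k)
  have hB : missSum T 0 ((n : ℤ) - 1) = B.card := by
    unfold missSum
    congr!
  have key : missSum (T.image Nat.succ) 0 ((n + 2 : ℕ) - 1 : ℤ) =
      (insert 0 (insert 1 (B.image (· + 2)))).card := by
    unfold missSum
    congr 1
    ext k
    simp only [Finset.mem_filter, Finset.mem_insert, Finset.mem_image, Finset.mem_Icc, B]
    constructor
    · rintro ⟨⟨h0, h1⟩, h⟩
      by_cases hk0 : k = 0
      · exact Or.inl hk0
      by_cases hk1 : k = 1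
      · exact Or.inr (Or.inl hk1)
      refine Or.inr (Or.inr ⟨k - 2, ⟨⟨by omega, by push_cast at h1; omega⟩, ?_⟩, by ring⟩)
      rintro ⟨x, hx, y, hy, hxy⟩
      exact h ⟨x + 1, ⟨x, hx, rfl⟩, y + 1, ⟨y, hy, rfl⟩, by push_cast; omega⟩
    · rintro (rfl | rfl | ⟨j, ⟨⟨h0, h1⟩, h⟩, rfl⟩)
      · refine ⟨⟨le_rfl, by push_cast; omega⟩, ?_⟩
        rintro ⟨_, ⟨x, hx, rfl⟩, _, ⟨y, hy, rfl⟩, hxy⟩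
        push_cast at hxy
        omega
      · refine ⟨⟨by omega, by push_cast; omega⟩, ?_⟩
        rintro ⟨_, ⟨x, hx, rfl⟩, _, ⟨y, hy, rfl⟩, hxy⟩
        push_cast at hxy
        omega
      · refine ⟨⟨by omega, by push_cast; omega⟩, ?_⟩
        rintro ⟨_, ⟨x, hx, rfl⟩, _, ⟨y, hy, rfl⟩, hxy⟩
        push_cast at hxy
        exact h ⟨x, hx, y, hy, by omega⟩
  have hnonneg : ∀ j ∈ B, 0 ≤ j := fun j hj =>
    (Finset.mem_Icc.1 (Finset.mem_filter.1 hj).1).1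
  rw [key, hB, Finset.card_insert_of_notMem, Finset.card_insert_of_notMem,
    Finset.card_image_of_injective _ (add_left_injective 2)]
  · simp only [Finset.mem_image, not_exists, not_and]
    intro j hj
    have := hnonneg j hj
    omega
  · simp only [Finset.mem_insert, Finset.mem_image, not_or, not_exists, not_and]
    refine ⟨by norm_num, fun j hj => ?_⟩
    have := hnonneg j hj
    omega

theorem pR_eq_card_div (n : ℕ) (p : Finset ℕ → Prop) [DecidablePred p] :
    pR n p = (((Finset.range n).powerset.filter p).card : ℝ) / 2 ^ n := by
  unfold pR
  congr!

theorem pR'_eq_card_div (n : ℕ) (p : Finset ℕ → Prop) [DecidablePred p] :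
    pR' n p =
      (((Finset.range n).powerset.filter (fun S => 0 ∈ S ∧ p S)).card : ℝ) / 2 ^ (n - 1) := by
  unfold pR'
  congr!

/-- Splitting the subsets of `range (n + 1)` according to whether they contain `n`. -/
theorem card_filter_powerset_range_succ (n : ℕ) (p : Finset ℕ → Prop) [DecidablePred p] :
    ((Finset.range (n + 1)).powerset.filter p).card =
      ((Finset.range n).powerset.filter p).card +
        ((Finset.range n).powerset.filter (fun S => p (insert n S))).card := by
  simp only [Finset.card_filter]
  rw [Finset.range_add_one, Finset.sum_powerset_insert Finset.notMem_range_self]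

/-- Splitting the subsets of `range (n + 1)` according to whether they contain `0`. -/
theorem card_filter_powerset_range_succ' (n : ℕ) (p : Finset ℕ → Prop) [DecidablePred p] :
    ((Finset.range (n + 1)).powerset.filter p).card =
      ((Finset.range (n + 1)).powerset.filter (fun S => 0 ∈ S ∧ p S)).card +
        ((Finset.range n).powerset.filter (fun T => p (T.image Nat.succ))).card := by
  rw [← Finset.card_filter_add_card_filter_not (s := (Finset.range (n + 1)).powerset.filter p)
    (fun S => 0 ∈ S), Finset.filter_filter, Finset.filter_filter]
  congr 1
  · congr 1
    exact Finset.filter_congr fun S _ => and_comm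
  · symm
    refine Finset.card_bij (fun T _ => T.image Nat.succ) ?_ ?_ ?_
    · intro T hT
      simp only [Finset.mem_filter, Finset.mem_powerset] at hT ⊢
      refine ⟨fun x hx => ?_, hT.2, by simp⟩
      obtain ⟨y, hy, rfl⟩ := Finset.mem_image.1 hx
      have := Finset.mem_range.1 (hT.1 hy)
      exact Finset.mem_range.2 (by omega)
    · intro T _ T' _ h
      exact Finset.image_injective Nat.succ_injective h
    · intro S hS
      simp only [Finset.mem_filter, Finset.mem_powerset] at hS
      obtain ⟨hS, hp, h0⟩ := hS
      have him : (S.image Nat.pred).image Nat.succ = S := by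
        rw [Finset.image_image]
        refine (Finset.image_congr fun x hx => ?_).trans Finset.image_id
        exact Nat.succ_pred fun h => h0 (h ▸ hx)
      refine ⟨S.image Nat.pred, ?_, him⟩
      simp only [Finset.mem_filter, Finset.mem_powerset]
      refine ⟨fun x hx => ?_, by rwa [him]⟩
      have := Finset.mem_range.1 (hS (him ▸ Finset.mem_image_of_mem Nat.succ hx))
      exact Finset.mem_range.2 (by omega)

/-- Since the number of missing sums in `[0, n - 1]` grows with `n`, the probability that it is
at most `i` decreases. -/
theorem pR'_missSum_le_succ (i n : ℕ) :
    pR' (n + 1 + 1) (fun S => missSum S 0 (((n + 1 + 1 : ℕ) : ℤ) - 1) ≤ i) ≤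
      pR' (n + 1) (fun S => missSum S 0 (((n + 1 : ℕ) : ℤ) - 1) ≤ i) := by
  rw [pR'_eq_card_div, pR'_eq_card_div, Nat.add_sub_cancel, Nat.add_sub_cancel, div_le_div_iff₀ (by positivity) (by positivity),
    pow_succ, card_filter_powerset_range_succ (n + 1)]
  have hmono (S : Finset ℕ) : missSum S 0 (((n + 1 : ℕ) : ℤ) - 1) ≤
      missSum S 0 (((n + 1 + 1 : ℕ) : ℤ) - 1) :=
    missSum_mono_right S (by push_cast; omega)
  have h1 : ((Finset.range (n + 1)).powerset.filter
        (fun S => 0 ∈ S ∧ missSum S 0 (((n + 1 + 1 : ℕ) : ℤ) - 1) ≤ i)).card ≤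
      ((Finset.range (n + 1)).powerset.filter
        (fun S => 0 ∈ S ∧ missSum S 0 (((n + 1 : ℕ) : ℤ) - 1) ≤ i)).card :=
    Finset.card_le_card (Finset.monotone_filter_right _
      fun S _ hS => ⟨hS.1, (hmono S).trans hS.2⟩)
  have h2 : ((Finset.range (n + 1)).powerset.filter
        (fun S => 0 ∈ insert (n + 1) S ∧
          missSum (insert (n + 1) S) 0 (((n + 1 + 1 : ℕ) : ℤ) - 1) ≤ i)).card ≤
      ((Finset.range (n + 1)).powerset.filter
        (fun S => 0 ∈ S ∧ missSum S 0 (((n + 1 : ℕ) : ℤ) - 1) ≤ i)).card := by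
    refine Finset.card_le_card (Finset.monotone_filter_right _ fun S _ hS => ⟨?_, ?_⟩)
    · exact (Finset.mem_insert.1 hS.1).resolve_left (by omega)
    · rw [← missSum_insert_self]
      exact (hmono _).trans hS.2
  have h3 := add_le_add h1 h2
  rw [← Nat.cast_le (α := ℝ)] at h3
  push_cast at h3 ⊢
  nlinarith [pow_pos (two_pos (α := ℝ)) n]

theorem exists_tendsto_pR'_missSum_le (i : ℕ) :
    ∃ l : ℝ, Tendsto (fun n : ℕ => pR' n (fun S => missSum S 0 ((n : ℤ) - 1) ≤ i))
      atTop (nhds l) := by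
  have hanti : Antitone fun n : ℕ =>
      pR' (n + 1) (fun S => missSum S 0 (((n + 1 : ℕ) : ℤ) - 1) ≤ i) :=
    antitone_nat_of_succ_le (pR'_missSum_le_succ i)
  have hbdd : BddBelow (Set.range fun n : ℕ =>
      pR' (n + 1) (fun S => missSum S 0 (((n + 1 : ℕ) : ℤ) - 1) ≤ i)) := by
    refine ⟨0, ?_⟩
    rintro _ ⟨n, rfl⟩
    exact div_nonneg (Nat.cast_nonneg _) (by positivity)
  exact ⟨_, (tendsto_add_atTop_iff_nat 1).1 (tendsto_atTop_ciInf hanti hbdd)⟩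

theorem pR'_le_succ_eq_add (n i : ℕ) (f : Finset ℕ → ℕ) :
    pR' n (fun S => f S ≤ i + 1) = pR' n (fun S => f S ≤ i) + pR' n (fun S => f S = i + 1) := by
  rw [pR'_eq_card_div, pR'_eq_card_div, pR'_eq_card_div, ← add_div, ← Nat.cast_add, ← Finset.card_union_of_disjoint, ← Finset.filter_or]
  · congr 3
    refine Finset.filter_congr fun S _ => ?_
    rw [← and_or_left, Nat.le_succ_iff]
  · refine Finset.disjoint_filter.2 fun S _ h h' => ?_
    have := h.2
    have := h'.2
    omega

theorem exists_tendsto_pR'_missSum_eq (i : ℕ) :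
    ∃ l : ℝ, Tendsto (fun n : ℕ => pR' n (fun S => missSum S 0 ((n : ℤ) - 1) = i))
      atTop (nhds l) := by
  cases i with
  | zero => simpa only [Nat.le_zero] using exists_tendsto_pR'_missSum_le 0
  | succ i =>
    obtain ⟨a, ha⟩ := exists_tendsto_pR'_missSum_le i
    obtain ⟨b, hb⟩ := exists_tendsto_pR'_missSum_le (i + 1)
    refine ⟨b - a, (hb.sub ha).congr fun n => ?_⟩
    rw [pR'_le_succ_eq_add, add_sub_cancel_left]

/-- Conditioning on whether `0` belongs to the random set. -/
theorem pR_missSum_add_two (n m : ℕ) :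
    pR (n + 2) (fun S => missSum S 0 (((n + 2 : ℕ) : ℤ) - 1) = m) =
      1 / 2 * pR' (n + 2) (fun S => missSum S 0 (((n + 2 : ℕ) : ℤ) - 1) = m) +
        1 / 2 * pR n (fun S => missSum S 0 ((n : ℤ) - 1) + 2 = m) := by
  have hcard : ((Finset.range (n + 2)).powerset.filter
        (fun S => missSum S 0 (((n + 2 : ℕ) : ℤ) - 1) = m)).card =
      ((Finset.range (n + 2)).powerset.filter
        (fun S => 0 ∈ S ∧ missSum S 0 (((n + 2 : ℕ) : ℤ) - 1) = m)).card +
        2 * ((Finset.range n).powerset.filter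
        (fun S => missSum S 0 ((n : ℤ) - 1) + 2 = m)).card := by
    rw [card_filter_powerset_range_succ' (n + 1)]
    simp only [missSum_image_succ]
    rw [card_filter_powerset_range_succ n]
    simp only [missSum_insert_self]
    rw [two_mul]
  rw [pR_eq_card_div, pR'_eq_card_div, pR_eq_card_div, show n + 2 - 1 = n + 1 from rfl]
  have hcast := congrArg (Nat.cast : ℕ → ℝ) hcard
  push_cast at hcast ⊢
  rw [show (2 : ℝ) ^ (n + 2) = 2 ^ n * 4 by ring, show (2 : ℝ) ^ (n + 1) = 2 ^ n * 2 by ring]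
  field_simp
  linarith

theorem pR_of_forall_not (n : ℕ) {p : Finset ℕ → Prop} (h : ∀ S, ¬ p S) : pR n p = 0 := by
  classical
  simp [pR, h]

theorem tendsto_pR_missSum_of_lt_two {m : ℕ} (hm : m < 2) {l : ℝ}
    (h : Tendsto (fun n : ℕ => pR' n (fun S => missSum S 0 ((n : ℤ) - 1) = m)) atTop (nhds l)) :
    Tendsto (fun n : ℕ => pR n (fun S => missSum S 0 ((n : ℤ) - 1) = m)) atTop
      (nhds (1 / 2 * l)) := by
  rw [← tendsto_add_atTop_iff_nat 2] at h ⊢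
  refine (h.const_mul (1 / 2)).congr fun n => ?_
  rw [pR_missSum_add_two, pR_of_forall_not n fun S => by omega, mul_zero, add_zero]

theorem tendsto_pR_missSum {L : ℕ → ℝ}
    (hL : ∀ i, Tendsto (fun n : ℕ => pR' n (fun S => missSum S 0 ((n : ℤ) - 1) = i))
      atTop (nhds (L i))) (m : ℕ) :
    Tendsto (fun n : ℕ => pR n (fun S => missSum S 0 ((n : ℤ) - 1) = m)) atTop
      (nhds (∑ i ∈ Finset.range (m / 2 + 1), (1 / 2 ^ (i + 1) : ℝ) * L (m - 2 * i))) := by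
  induction m using Nat.twoStepInduction with
  | zero => simpa using tendsto_pR_missSum_of_lt_two (by norm_num) (hL 0)
  | one => simpa using tendsto_pR_missSum_of_lt_two (by norm_num) (hL 1)
  | more m ih _ =>
    have hsum : ∑ i ∈ Finset.range ((m + 2) / 2 + 1),
          (1 / 2 ^ (i + 1) : ℝ) * L (m + 2 - 2 * i) =
        1 / 2 * L (m + 2) + 1 / 2 * ∑ i ∈ Finset.range (m / 2 + 1),
          (1 / 2 ^ (i + 1) : ℝ) * L (m - 2 * i) := by
      rw [show (m + 2) / 2 + 1 = m / 2 + 1 + 1 by omega, Finset.sum_range_succ', add_comm,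
        Finset.mul_sum]
      congr 1
      · simp
      · refine Finset.sum_congr rfl fun i _ => ?_
        rw [show m + 2 - 2 * (i + 1) = m - 2 * i by omega, pow_succ 2 (i + 1)]
        field_simp
    have hL' := (tendsto_add_atTop_iff_nat 2).2 (hL (m + 2))
    rw [hsum, ← tendsto_add_atTop_iff_nat 2]
    refine ((hL'.const_mul (1 / 2)).add (ih.const_mul (1 / 2))).congr fun n => ?_
    rw [pR_missSum_add_two]
    simp only [Nat.add_right_cancel_iff]

/-- For every nonnegative integer `m`,
`lim_{n→∞} P(f⁺_{[0,n-1]}(R_n) = m) = Σ_{i=0}^{⌊m/2⌋} (1/2^{i+1}) · lim P(f⁺_{[0,n-1]}(R_n') = m-2i)`,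
where all the indicated limits exist. -/
theorem missing_sums_small_eq_shifted (m : ℕ) :
    ∃ L : ℕ → ℝ,
      (∀ i ≤ m, Tendsto (fun n : ℕ => pR' n (fun S => missSum S 0 ((n : ℤ) - 1) = i))
        atTop (nhds (L i))) ∧
      Tendsto (fun n : ℕ => pR n (fun S => missSum S 0 ((n : ℤ) - 1) = m)) atTop
        (nhds (∑ i ∈ Finset.range (m / 2 + 1), (1 / 2 ^ (i + 1) : ℝ) * L (m - 2 * i))) := by
  choose L hL using exists_tendsto_pR'_missSum_eq
  exact ⟨L, fun i _ => hL i, tendsto_pR_missSum hL m⟩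
end

section
/- lim_{n→∞} P(f⁺_{[⌊n/8⌋, (2n−2)−⌊n/8⌋]}(R_n) ≥ 1) = 0; that is, the probability that R_n + R_n misses at least one sum in the middle interval [⌊n/8⌋, (2n−2)−⌊n/8⌋] tends to 0 as n → ∞. -/
open Finset Filter

/-- Among the subsets of `U`, where `U` contains the integer interval `[lo, hi]`, those with no two
elements adding up to `lo + hi` have density at most `(3 / 4) ^ m`, as long as `[lo, hi]` contains
`m` disjoint pairs `{lo + i, hi - i}`. -/
lemma card_subsets_avoiding_sum_mul_four_pow_le (k m : ℕ) (U : Finset ℕ) (lo hi : ℕ)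
    (hU : Finset.Icc lo hi ⊆ U) (hk : lo + hi = k) (hm : lo + 2 * m ≤ hi + 1) :
    (U.powerset.filter (fun S => ∀ x ∈ S, ∀ y ∈ S, x + y ≠ k)).card * 4 ^ m
      ≤ 3 ^ m * 2 ^ U.card := by
  induction m generalizing U lo hi with
  | zero => simpa using Finset.card_filter_le U.powerset _
  | succ m ih =>
    obtain ⟨hi, rfl⟩ : ∃ h, hi = h + 1 := ⟨hi - 1, by lia⟩
    have hlo : lo ∈ U := hU (by simp; lia)
    have hhi : hi + 1 ∈ U := hU (by simp; lia)
    have hne : lo ≠ hi + 1 := by lia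
    set V := (U.erase lo).erase (hi + 1) with hV
    have hcard : U.card = V.card + 2 := by
      rw [← Finset.card_erase_add_one hlo,
        ← Finset.card_erase_add_one (Finset.mem_erase.2 ⟨hne.symm, hhi⟩)]
    have hVsub : Finset.Icc (lo + 1) hi ⊆ V := by
      intro x hx
      rw [Finset.mem_Icc] at hx
      simp only [hV, Finset.mem_erase]
      exact ⟨by lia, by lia, hU (by simp; lia)⟩
    have hIH := ih V (lo + 1) hi hVsub (by lia) (by lia)
    have hsub : U.powerset.filter (fun S => ∀ x ∈ S, ∀ y ∈ S, x + y ≠ k) ⊆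
        ((V.powerset.filter (fun S => ∀ x ∈ S, ∀ y ∈ S, x + y ≠ k)) ×ˢ
          ({∅, {lo}, {hi + 1}} : Finset (Finset ℕ))).image (fun p => p.1 ∪ p.2) := by
      intro S hS
      simp only [Finset.mem_filter, Finset.mem_powerset] at hS
      obtain ⟨hSU, hSk⟩ := hS
      have hnot : ¬ (lo ∈ S ∧ hi + 1 ∈ S) := fun h => hSk _ h.1 _ h.2 hk
      have hpart : S ∩ {lo, hi + 1} ∈ ({∅, {lo}, {hi + 1}} : Finset (Finset ℕ)) := by
        by_cases h1 : lo ∈ S <;> by_cases h2 : hi + 1 ∈ S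
        · exact absurd ⟨h1, h2⟩ hnot
        all_goals simp [h1, h2, Finset.inter_singleton_of_notMem]
      refine Finset.mem_image.2 ⟨(S ∩ V, S ∩ {lo, hi + 1}), Finset.mem_product.2 ⟨?_, hpart⟩, ?_⟩
      · simp only [Finset.mem_filter, Finset.mem_powerset]
        exact ⟨Finset.inter_subset_right, fun x hx y hy =>
          hSk x (Finset.mem_inter.1 hx).1 y (Finset.mem_inter.1 hy).1⟩
      · ext x
        have := @hSU x
        simp only [hV, Finset.mem_union, Finset.mem_inter, Finset.mem_erase, Finset.mem_insert,
          Finset.mem_singleton]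
        tauto
    have hle := (Finset.card_le_card hsub).trans Finset.card_image_le
    rw [Finset.card_product] at hle
    have h3 : ({∅, {lo}, {hi + 1}} : Finset (Finset ℕ)).card ≤ 3 := Finset.card_le_three
    have hle' := hle.trans (Nat.mul_le_mul_left _ h3)
    rw [hcard, pow_succ, pow_succ, pow_add]
    nlinarith [Nat.mul_le_mul_right (4 ^ m) hle']

/-- A fixed sum `k` of the middle interval is missed with probability at most
`(3 / 4) ^ (n / 16)`. -/
lemma card_subsets_range_avoiding_sum_le (n k : ℕ) (h1 : n / 8 ≤ k) (h2 : k + n / 8 + 2 ≤ 2 * n) :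
    ((Finset.range n).powerset.filter (fun S => ∀ x ∈ S, ∀ y ∈ S, x + y ≠ k)).card * 4 ^ (n / 16)
      ≤ 3 ^ (n / 16) * 2 ^ n := by
  have key : ∀ lo hi : ℕ, hi < n → lo + hi = k → lo + 2 * (n / 16) ≤ hi + 1 →
      ((Finset.range n).powerset.filter (fun S => ∀ x ∈ S, ∀ y ∈ S, x + y ≠ k)).card *
        4 ^ (n / 16) ≤ 3 ^ (n / 16) * 2 ^ n := by
    intro lo hi hhi hk hm
    have h := card_subsets_avoiding_sum_mul_four_pow_le k (n / 16) (Finset.range n) lo hi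
      (fun x hx => by simp at hx ⊢; lia) hk hm
    rwa [Finset.card_range] at h
  rcases lt_or_ge k n with h | h
  · exact key 0 k h (by lia) (by lia)
  · exact key (k - (n - 1)) (n - 1) (by lia) (by lia) (by lia)

/-- Union bound for the probability of missing a sum of the middle interval. -/
lemma pR_one_le_missSum_middle_le (n : ℕ) :
    pR n (fun S => 1 ≤ missSum S ((n / 8 : ℕ) : ℤ) (2 * (n : ℤ) - 2 - ((n / 8 : ℕ) : ℤ)))
      ≤ 2 * n * (3 / 4 : ℝ) ^ (n / 16) := by
  classical
  set K := (Finset.range (2 * n)).filter (fun k => n / 8 ≤ k ∧ k + n / 8 + 2 ≤ 2 * n) with hK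
  set A : ℕ → Finset (Finset ℕ) := fun k =>
    (Finset.range n).powerset.filter (fun S => ∀ x ∈ S, ∀ y ∈ S, x + y ≠ k) with hA
  have hA_le : ∀ k ∈ K, ((A k).card : ℝ) ≤ (3 / 4 : ℝ) ^ (n / 16) * 2 ^ n := by
    intro k hk
    simp only [hK, Finset.mem_filter] at hk
    have h : ((A k).card : ℝ) * 4 ^ (n / 16) ≤ 3 ^ (n / 16) * 2 ^ n :=
      mod_cast card_subsets_range_avoiding_sum_le n k hk.2.1 hk.2.2
    rw [div_pow, div_mul_eq_mul_div, le_div_iff₀ (by positivity)]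
    exact h
  have hK_card : (K.card : ℝ) ≤ 2 * n := by
    have h := Finset.card_filter_le (Finset.range (2 * n))
      (fun k => n / 8 ≤ k ∧ k + n / 8 + 2 ≤ 2 * n)
    rw [Finset.card_range] at h
    exact_mod_cast h
  unfold pR
  rw [div_le_iff₀ (by positivity)]
  have hsub : (Finset.range n).powerset.filter (fun S =>
      1 ≤ missSum S ((n / 8 : ℕ) : ℤ) (2 * (n : ℤ) - 2 - ((n / 8 : ℕ) : ℤ))) ⊆ K.biUnion A := by
    intro S hS
    rw [Finset.mem_filter] at hS
    obtain ⟨hSn, hmiss⟩ := hS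
    unfold missSum at hmiss
    obtain ⟨k, hk⟩ := Finset.card_pos.1 hmiss
    rw [Finset.mem_filter, Finset.mem_Icc] at hk
    obtain ⟨⟨hk1, hk2⟩, hk3⟩ := hk
    lift k to ℕ using (by lia)
    refine Finset.mem_biUnion.2 ⟨k, ?_, ?_⟩
    · rw [hK, Finset.mem_filter, Finset.mem_range]
      lia
    · rw [hA, Finset.mem_filter]
      exact ⟨hSn, fun x hx y hy hxy => hk3 ⟨x, hx, y, hy, mod_cast hxy⟩⟩
  calc _ ≤ (((K.biUnion A).card : ℕ) : ℝ) := Nat.cast_le.2 (Finset.card_le_card (by convert hsub))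
    _ ≤ ∑ k ∈ K, ((A k).card : ℝ) := mod_cast Finset.card_biUnion_le
    _ ≤ ∑ _k ∈ K, (3 / 4 : ℝ) ^ (n / 16) * 2 ^ n := Finset.sum_le_sum hA_le
    _ = K.card * ((3 / 4 : ℝ) ^ (n / 16) * 2 ^ n) := by rw [Finset.sum_const, nsmul_eq_mul]
    _ ≤ 2 * n * ((3 / 4 : ℝ) ^ (n / 16) * 2 ^ n) := by gcongr
    _ = _ := by ring

lemma tendsto_two_mul_mul_three_quarters_pow_div_sixteen :
    Tendsto (fun n : ℕ => 2 * (n : ℝ) * (3 / 4 : ℝ) ^ (n / 16)) atTop (nhds 0) := by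
  have hdiv : Tendsto (fun n : ℕ => n / 16) atTop atTop :=
    Nat.tendsto_div_const_atTop (by norm_num)
  have h1 : Tendsto (fun m : ℕ => (m : ℝ) * (3 / 4 : ℝ) ^ m) atTop (nhds 0) :=
    tendsto_self_mul_const_pow_of_lt_one (by norm_num) (by norm_num)
  have h2 : Tendsto (fun m : ℕ => (3 / 4 : ℝ) ^ m) atTop (nhds 0) :=
    tendsto_pow_atTop_nhds_zero_of_lt_one (by norm_num) (by norm_num)
  have h3 := ((h1.const_mul 32).add (h2.const_mul 32)).comp hdiv
  simp only [mul_zero, add_zero] at h3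
  refine squeeze_zero (fun n => by positivity) (fun n => ?_) h3
  have hn : (n : ℝ) ≤ 16 * ((n / 16 : ℕ) : ℝ) + 16 := by
    have : n ≤ 16 * (n / 16) + 16 := by lia
    exact_mod_cast this
  have hp : (0 : ℝ) ≤ (3 / 4 : ℝ) ^ (n / 16) := by positivity
  simp only [Function.comp_apply]
  nlinarith [mul_le_mul_of_nonneg_right hn hp]

/-- The probability that `R_n + R_n` misses at least one sum in the
middle interval `[⌊n/8⌋, (2n-2) - ⌊n/8⌋]` tends to `0` as `n → ∞`. -/
theorem prob_missing_middle_sum_tendsto_zero :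
    Tendsto (fun n : ℕ =>
        pR n (fun S => 1 ≤ missSum S ((n / 8 : ℕ) : ℤ) (2 * (n : ℤ) - 2 - ((n / 8 : ℕ) : ℤ))))
      atTop (nhds 0) := by
  exact squeeze_zero (fun n => by unfold pR; positivity) pR_one_le_missSum_middle_le
    tendsto_two_mul_mul_three_quarters_pow_div_sixteen
end

section
/- For every integer n ≥ 1 and every integer k with 0 ≤ k ≤ n−1, the probability that k does not lie in R_n + R_n is at most (3/4)^{⌊k/2⌋}. -/
open Finset Filter

/-- Among the subsets of `A`, the proportion of those containing none of the disjoint pairs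
`{i, k - i}` with `i < m` is at most `(3/4)^m`, provided `A` contains all these pairs. -/
theorem card_filter_avoid_pairs_le {k m : ℕ} (hm : 2 * m ≤ k) {A : Finset ℕ}
    (hA : ∀ i < m, i ∈ A ∧ k - i ∈ A) :
    #{S ∈ A.powerset | ∀ i < m, ¬ (i ∈ S ∧ k - i ∈ S)} * 4 ^ m ≤ 3 ^ m * 2 ^ #A := by
  induction m generalizing A with
  | zero => simp
  | succ m ih =>
    have hne : m ≠ k - m := by omega
    obtain ⟨hmA, hkA⟩ := hA m (Nat.lt_succ_self m)
    set P : Finset ℕ := {m, k - m} with hP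
    have hPA : P ⊆ A := by simp [hP, insert_subset_iff, hmA, hkA]
    have hcard : #(A \ P) + 2 = #A := by
      rw [← card_sdiff_add_card_eq_card hPA, hP, card_pair hne]
    have hB := ih (A := A \ P) (by omega) fun i hi => by
      have := hA i (by omega)
      simp only [Finset.mem_sdiff, hP, mem_insert, mem_singleton]
      exact ⟨⟨this.1, by omega⟩, this.2, by omega⟩
    have hinj : #{S ∈ A.powerset | ∀ i < m + 1, ¬ (i ∈ S ∧ k - i ∈ S)} ≤
        #((P.powerset.erase P) ×ˢ
          {S ∈ (A \ P).powerset | ∀ i < m, ¬ (i ∈ S ∧ k - i ∈ S)}) := by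
      refine card_le_card_of_injOn (fun S => (S ∩ P, S \ P)) ?_ ?_
      · intro S hS
        simp only [coe_filter, mem_powerset, Set.mem_ofPred_eq] at hS
        simp only [coe_product, Set.mem_prod, mem_coe, mem_erase, mem_powerset, mem_filter]
        refine ⟨⟨fun h => hS.2 m (Nat.lt_succ_self m) ?_, inter_subset_right⟩,
          sdiff_subset_sdiff hS.1 subset_rfl, fun i hi h => hS.2 i (by omega) ?_⟩
        · have hPS := inter_eq_right.mp h
          exact ⟨hPS (by simp [hP]), hPS (by simp [hP])⟩
        · exact ⟨(Finset.mem_sdiff.mp h.1).1, (Finset.mem_sdiff.mp h.2).1⟩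
      · intro S _ T _ h
        obtain ⟨h₁, h₂⟩ := Prod.mk.inj h
        rw [← sdiff_union_inter S P, ← sdiff_union_inter T P, h₁, h₂]
    rw [card_product, card_erase_of_mem (mem_powerset_self P), card_powerset, hP,
      card_pair hne, ← hP] at hinj
    rw [← hcard]
    calc _ ≤ (2 ^ 2 - 1) * _ * 4 ^ (m + 1) := Nat.mul_le_mul_right _ hinj
      _ = 12 * (#{S ∈ (A \ P).powerset | ∀ i < m, ¬ (i ∈ S ∧ k - i ∈ S)} * 4 ^ m) := by ring
      _ ≤ 12 * (3 ^ m * 2 ^ #(A \ P)) := Nat.mul_le_mul_left _ hB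
      _ = 3 ^ (m + 1) * 2 ^ (#(A \ P) + 2) := by ring

/-- For every integer `n ≥ 1` and every integer `k` with `0 ≤ k ≤ n-1`,
the probability that `k ∉ R_n + R_n` is at most `(3/4)^⌊k/2⌋`. -/
theorem prob_not_mem_sumset_le (n k : ℕ) (hn : 1 ≤ n) (hk : k ≤ n - 1) :
    pR n (fun S => ¬ ∃ x ∈ S, ∃ y ∈ S, x + y = k) ≤ (3 / 4 : ℝ) ^ (k / 2) := by
  classical
  have hcount := card_filter_avoid_pairs_le (k := k) (m := k / 2) (A := range n) (by omega)
    fun i hi => ⟨mem_range.mpr (by omega), mem_range.mpr (by omega)⟩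
  rw [card_range] at hcount
  have hsub : #{S ∈ (range n).powerset | ¬ ∃ x ∈ S, ∃ y ∈ S, x + y = k} ≤
      #{S ∈ (range n).powerset | ∀ i < k / 2, ¬ (i ∈ S ∧ k - i ∈ S)} := by
    refine card_le_card (monotone_filter_right _ fun S _ hS i hi h => ?_)
    exact hS ⟨i, h.1, k - i, h.2, by omega⟩
  have hreal : (#{S ∈ (range n).powerset | ¬ ∃ x ∈ S, ∃ y ∈ S, x + y = k} : ℝ) * 4 ^ (k / 2) ≤
      3 ^ (k / 2) * 2 ^ n := by
    exact_mod_cast (Nat.mul_le_mul_right _ hsub).trans hcount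
  rw [pR, div_pow, div_le_div_iff₀ (by positivity) (by positivity)]
  refine le_of_eq_of_le ?_ hreal
  congr!
end

section
/- For every nonnegative integer m, lim_{n→∞} Σ_{a,c ≥ 0, b ≥ 1, a+b+c = m} P(f⁺_{[0,⌊n/8⌋−1]}(R_n) = a ∧ f⁺_{[⌊n/8⌋,(2n−2)−⌊n/8⌋]}(R_n) = b ∧ f⁺_{[(2n−2)−⌊n/8⌋+1, 2n−2]}(R_n) = c) = 0. -/
open Finset Filter

open Classical in
/-- Among the subsets of `U`, a proportion of at most `(3/4)^t` contains none of the `t` pairwise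
disjoint pairs `{f i, g i}` of elements of `U`. -/
lemma card_powerset_filter_avoid_pairs_le (f g : ℕ → ℕ) (t : ℕ) :
    ∀ U : Finset ℕ, (∀ i < t, f i ∈ U ∧ g i ∈ U) →
      (∀ i < t, ∀ j < t, f i ≠ g j ∧ (f i = f j → i = j) ∧ (g i = g j → i = j)) →
      (U.powerset.filter (fun S => ∀ i < t, ¬ (f i ∈ S ∧ g i ∈ S))).card * 4 ^ t
        ≤ 3 ^ t * 2 ^ U.card := by
  induction t with
  | zero => intro U _ _; simp
  | succ t ih =>
    intro U hU hd
    have hft := (hU t (by lia)).1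
    have hgt := (hU t (by lia)).2
    have hne : f t ≠ g t := (hd t (by lia) t (by lia)).1
    set V : Finset ℕ := (U.erase (f t)).erase (g t) with hV
    have hcard : V.card + 2 = U.card := by
      have h1 : g t ∈ U.erase (f t) := mem_erase.2 ⟨hne.symm, hgt⟩
      have h2 := card_erase_add_one h1
      have h3 := card_erase_add_one hft
      lia
    have key := ih V
      (fun i hi => by
        have h1 := hd i (by lia) t (by lia)
        have h2 := hd t (by lia) i (by lia)
        have h3 := hU i (by lia)
        simp only [hV, mem_erase]
        exact ⟨⟨h1.1, fun h => by have := h1.2.1 h; lia, h3.1⟩,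
          ⟨fun h => by have := h1.2.2 h; lia, h2.1.symm, h3.2⟩⟩)
      (fun i hi j hj => hd i (by lia) j (by lia))
    set F := U.powerset.filter (fun S => ∀ i < t + 1, ¬ (f i ∈ S ∧ g i ∈ S))
    set G := V.powerset.filter (fun S => ∀ i < t, ¬ (f i ∈ S ∧ g i ∈ S))
    have hle : F.card ≤ (G ×ˢ ({(true, false), (false, true), (false, false)} :
        Finset (Bool × Bool))).card := by
      apply card_le_card_of_injOn
        (fun S => ((S.erase (f t)).erase (g t), (decide (f t ∈ S), decide (g t ∈ S))))
      · intro S hS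
        simp only [F, coe_filter, mem_powerset, Set.mem_ofPred_eq] at hS
        have ht := hS.2 t (by lia)
        simp only [coe_product, Set.mem_prod, mem_coe]
        refine ⟨?_, ?_⟩
        · simp only [G, mem_filter, mem_powerset]
          refine ⟨erase_subset_erase _ (erase_subset_erase _ hS.1), fun i hi h => ?_⟩
          exact hS.2 i (by lia) ⟨mem_of_mem_erase (mem_of_mem_erase h.1),
            mem_of_mem_erase (mem_of_mem_erase h.2)⟩
        · rcases Classical.not_and_iff_not_or_not.1 ht with h | h
          · by_cases h2 : g t ∈ S <;> simp [h, h2]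
          · by_cases h2 : f t ∈ S <;> simp [h, h2]
      · intro S _ T _ h
        simp only [Prod.mk.injEq, decide_eq_decide] at h
        ext x
        by_cases hx : x = f t
        · rw [hx]; exact h.2.1
        by_cases hx' : x = g t
        · rw [hx']; exact h.2.2
        have := congrArg (fun A => x ∈ A) h.1
        simpa [hx, hx'] using this
    rw [card_product] at hle
    have h3 : ({(true, false), (false, true), (false, false)} :
        Finset (Bool × Bool)).card = 3 := by decide
    rw [h3] at hle
    rw [← hcard]
    calc F.card * 4 ^ (t + 1) ≤ (G.card * 3) * 4 ^ (t + 1) := Nat.mul_le_mul_right _ hle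
      _ = 12 * (G.card * 4 ^ t) := by ring
      _ ≤ 12 * (3 ^ t * 2 ^ V.card) := Nat.mul_le_mul_left _ key
      _ = 3 ^ (t + 1) * 2 ^ (V.card + 2) := by ring

lemma pR_mono {n : ℕ} {p p' : Finset ℕ → Prop} (h : ∀ S, p S → p' S) : pR n p ≤ pR n p' := by
  unfold pR
  gcongr with S
  exact h S

lemma pR_nonneg (n : ℕ) (p : Finset ℕ → Prop) : 0 ≤ pR n p := by
  unfold pR; positivity

/-- The union bound. -/
lemma pR_exists_le_sum (n : ℕ) (K : Finset ℕ) (p : ℕ → Finset ℕ → Prop) :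
    pR n (fun S => ∃ k ∈ K, p k S) ≤ ∑ k ∈ K, pR n (p k) := by
  classical
  unfold pR
  rw [← sum_div]
  gcongr
  rw [← Nat.cast_sum, Nat.cast_le]
  refine le_trans (card_le_card fun S hS => ?_) card_biUnion_le
  simp only [mem_filter, mem_biUnion] at hS ⊢
  obtain ⟨hS, k, hk, hp⟩ := hS
  exact ⟨k, hk, hS, hp⟩

/-- A fixed `k` at distance at least `2t` from both ends of `[0, 2n-2]` is missing from the sumset
with probability at most `(3/4)^t`. -/
lemma pR_not_mem_add_le {n k t : ℕ} (h1 : 2 * t ≤ k) (h2 : k + 2 * t + 2 ≤ 2 * n) :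
    pR n (fun S => ¬ ∃ x ∈ S, ∃ y ∈ S, x + y = k) ≤ (3 / 4 : ℝ) ^ t := by
  classical
  have key := card_powerset_filter_avoid_pairs_le
    (fun i => (k + 1 - n) + i) (fun i => k - (k + 1 - n) - i) t (range n)
    (fun i hi => by simp only [mem_range]; lia) (fun i hi j hj => by lia)
  rw [card_range] at key
  refine le_trans (pR_mono (p' := fun S => ∀ i < t,
    ¬ ((k + 1 - n) + i ∈ S ∧ k - (k + 1 - n) - i ∈ S)) fun S hS i hi h =>
      hS ⟨_, h.1, _, h.2, by lia⟩) ?_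
  unfold pR
  rw [div_pow, div_le_div_iff₀ (by positivity) (by positivity)]
  norm_cast
  convert key

lemma exists_nat_of_missSum_pos {S : Finset ℕ} {a : ℕ} {c : ℤ}
    (h : 0 < missSum S a c) :
    ∃ k : ℕ, a ≤ k ∧ (k : ℤ) ≤ c ∧ ¬ ∃ x ∈ S, ∃ y ∈ S, x + y = k := by
  classical
  obtain ⟨k, hk⟩ := card_pos.1 h
  rw [mem_filter, mem_Icc] at hk
  obtain ⟨⟨hak, hkc⟩, hmiss⟩ := hk
  lift k to ℕ using by lia
  refine ⟨k, by exact_mod_cast hak, hkc, fun ⟨x, hx, y, hy, hxy⟩ => hmiss ⟨x, hx, y, hy, ?_⟩⟩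
  exact_mod_cast hxy

lemma pR_missSum_middle_pos_le (n : ℕ) :
    pR n (fun S => 0 < missSum S ((n / 8 : ℕ) : ℤ) (2 * (n : ℤ) - 2 - ((n / 8 : ℕ) : ℤ)))
      ≤ 2 * n * (3 / 4 : ℝ) ^ (n / 16) := by
  set K := (range (2 * n)).filter (fun k => n / 8 ≤ k ∧ k + n / 8 + 2 ≤ 2 * n)
  calc _ ≤ pR n (fun S => ∃ k ∈ K, ¬ ∃ x ∈ S, ∃ y ∈ S, x + y = k) := by
        refine pR_mono fun S hS => ?_
        obtain ⟨k, hk1, hk2, hk⟩ := exists_nat_of_missSum_pos hS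
        exact ⟨k, by simp only [K, mem_filter, mem_range]; lia, hk⟩
    _ ≤ ∑ k ∈ K, pR n (fun S => ¬ ∃ x ∈ S, ∃ y ∈ S, x + y = k) := pR_exists_le_sum n K _
    _ ≤ ∑ k ∈ K, (3 / 4 : ℝ) ^ (n / 16) := by
        refine sum_le_sum fun k hk => ?_
        simp only [K, mem_filter, mem_range] at hk
        exact pR_not_mem_add_le (by lia) (by lia)
    _ ≤ 2 * n * (3 / 4 : ℝ) ^ (n / 16) := by
        rw [sum_const, nsmul_eq_mul]
        gcongr
        have : K.card ≤ 2 * n := (card_filter_le _ _).trans_eq (card_range _)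
        exact_mod_cast this

lemma tendsto_two_mul_mul_pow_div_sixteen :
    Tendsto (fun n : ℕ => 2 * n * (3 / 4 : ℝ) ^ (n / 16)) atTop (nhds 0) := by
  have h1 : Tendsto (fun j : ℕ => (j : ℝ) * (3 / 4 : ℝ) ^ j) atTop (nhds 0) :=
    tendsto_self_mul_const_pow_of_lt_one (by norm_num) (by norm_num)
  have h2 : Tendsto (fun j : ℕ => (3 / 4 : ℝ) ^ j) atTop (nhds 0) :=
    tendsto_pow_atTop_nhds_zero_of_lt_one (by norm_num) (by norm_num)
  have h3 := ((h1.add h2).const_mul 32).comp (Nat.tendsto_div_const_atTop (n := 16) (by norm_num))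
  rw [add_zero, mul_zero] at h3
  refine squeeze_zero (fun n => by positivity) (fun n => ?_) h3
  have hn : (n : ℝ) ≤ 16 * ((n / 16 : ℕ) + 1) := by
    have : n ≤ 16 * (n / 16 + 1) := by lia
    exact_mod_cast this
  simp only [Function.comp]
  calc 2 * n * (3 / 4 : ℝ) ^ (n / 16)
      ≤ 2 * (16 * ((n / 16 : ℕ) + 1)) * (3 / 4 : ℝ) ^ (n / 16) := by gcongr
    _ = _ := by ring

/-- For every nonnegative integer `m`, the sum over all `a, c ≥ 0`,
`b ≥ 1` with `a + b + c = m` of the joint probabilities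
`P(f⁺_{XS}(R_n) = a ∧ f⁺_{M}(R_n) = b ∧ f⁺_{XL}(R_n) = c)` tends to `0` as `n → ∞`,
where `XS = [0, ⌊n/8⌋-1]`, `M = [⌊n/8⌋, (2n-2)-⌊n/8⌋]`, `XL = [(2n-2)-⌊n/8⌋+1, 2n-2]`.
(The triples are enumerated as `b ∈ [1,m]`, `a ∈ [0, m-b]`, `c = m - b - a`.) -/
theorem sum_joint_prob_middle_tendsto_zero (m : ℕ) :
    Tendsto (fun n : ℕ =>
        ∑ b ∈ Finset.Icc 1 m, ∑ a ∈ Finset.range (m - b + 1),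
          pR n (fun S =>
            missSum S 0 (((n / 8 : ℕ) : ℤ) - 1) = a ∧
            missSum S ((n / 8 : ℕ) : ℤ) (2 * (n : ℤ) - 2 - ((n / 8 : ℕ) : ℤ)) = b ∧
            missSum S (2 * (n : ℤ) - 2 - ((n / 8 : ℕ) : ℤ) + 1) (2 * (n : ℤ) - 2) = m - b - a))
      atTop (nhds 0) := by
  refine (tendsto_finsetSum _ fun b hb => tendsto_finsetSum _ fun a _ =>
    squeeze_zero (fun n => pR_nonneg n _) (fun n => le_trans (pR_mono fun S hS => ?_)
      (pR_missSum_middle_pos_le n)) tendsto_two_mul_mul_pow_div_sixteen).trans (by simp)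
  rw [hS.2.1]
  exact (mem_Icc.1 hb).1
end

section
/- For every integer n ≥ 2 with n ∉ {2, 3, 5, 9} (and in fact for all n ∉ {1,2,3,5,9}), the function m ↦ P(f⁻_{[0,n−1]}(R_n'') = m) on nonnegative integers m is not nonincreasing; that is, there exists an integer m ≥ 1 with P(f⁻_{[0,n−1]}(R_n'') = m) > P(f⁻_{[0,n−1]}(R_n'') = m−1). -/
open Finset Filter

/-- The nonnegative differences of a set of natural numbers. -/
def natDiffs (S : Finset ℕ) : Finset ℕ :=
  (S ×ˢ S).image fun p => p.1 - p.2

theorem mem_natDiffs {S : Finset ℕ} {d : ℕ} :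
    d ∈ natDiffs S ↔ ∃ x ∈ S, ∃ y ∈ S, x - y = d := by
  simp only [natDiffs, mem_image, mem_product, Prod.exists]
  constructor
  · rintro ⟨x, y, ⟨hx, hy⟩, h⟩
    exact ⟨x, hx, y, hy, h⟩
  · rintro ⟨x, hx, y, hy, h⟩
    exact ⟨x, y, ⟨hx, hy⟩, h⟩

theorem sub_mem_natDiffs {S : Finset ℕ} {x y : ℕ} (hx : x ∈ S) (hy : y ∈ S) :
    x - y ∈ natDiffs S :=
  mem_natDiffs.2 ⟨x, hx, y, hy, rfl⟩

theorem missDiff_add_card_natDiffs {S : Finset ℕ} {n : ℕ} (hS : S ⊆ range n) (h0 : 0 ∈ S) :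
    missDiff S 0 ((n : ℤ) - 1) + (natDiffs S).card = n := by
  classical
  have hD : (natDiffs S).card = ((Finset.Icc (0 : ℤ) ((n : ℤ) - 1)).filter
      (fun k => ∃ x ∈ S, ∃ y ∈ S, (x : ℤ) - (y : ℤ) = k)).card := by
    rw [← card_image_of_injective (natDiffs S) (Nat.cast_injective (R := ℤ))]
    congr 1
    ext k
    simp only [mem_image, mem_natDiffs, mem_filter, Finset.mem_Icc]
    constructor
    · rintro ⟨d, ⟨x, hx, y, hy, rfl⟩, rfl⟩
      have hxn := mem_range.1 (hS hx)
      refine ⟨by omega, ?_⟩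
      rcases le_total y x with hyx | hxy
      · exact ⟨x, hx, y, hy, by omega⟩
      · exact ⟨0, h0, 0, h0, by omega⟩
    · rintro ⟨hk, x, hx, y, hy, rfl⟩
      exact ⟨x - y, ⟨x, hx, y, hy, rfl⟩, by omega⟩
  rw [hD, missDiff, add_comm]
  have hcard := card_filter_add_card_filter_not (s := Finset.Icc (0 : ℤ) ((n : ℤ) - 1))
    (fun k => ∃ x ∈ S, ∃ y ∈ S, (x : ℤ) - (y : ℤ) = k)
  rw [Int.card_Icc] at hcard
  convert hcard using 1
  omega

/-- The subsets of `{0,…,k}` that contain `0` and `k` and have exactly `j` nonnegative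
differences. -/
def setsWithDiffs (k j : ℕ) : Finset (Finset ℕ) :=
  (range (k + 1)).powerset.filter fun S => 0 ∈ S ∧ k ∈ S ∧ (natDiffs S).card = j

theorem mem_setsWithDiffs {k j : ℕ} {S : Finset ℕ} :
    S ∈ setsWithDiffs k j ↔
      S ⊆ range (k + 1) ∧ 0 ∈ S ∧ k ∈ S ∧ (natDiffs S).card = j := by
  simp [setsWithDiffs]

theorem pR''_missDiff_eq {k j m : ℕ} (hm : m + j = k + 1) :
    pR'' (k + 1) (fun S => missDiff S 0 (((k + 1 : ℕ) : ℤ) - 1) = m) =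
      ((setsWithDiffs k j).card : ℝ) / 2 ^ (k - 1) := by
  classical
  have hcard : ((range (k + 1)).powerset.filter (fun S => 0 ∈ S ∧ k + 1 - 1 ∈ S ∧
      missDiff S 0 (((k + 1 : ℕ) : ℤ) - 1) = m)) = setsWithDiffs k j := by
    ext S
    rw [mem_setsWithDiffs, mem_filter, mem_powerset, Nat.add_sub_cancel]
    refine and_congr_right fun hS => and_congr_right fun h0 => and_congr_right fun _ => ?_
    have := missDiff_add_card_natDiffs hS h0
    omega
  rw [← hcard, pR'', show k + 1 - 2 = k - 1 by omega]
  congr!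

theorem exists_increase_of_card_lt {k j m : ℕ} (hm : m + j = k + 1) (hm1 : 1 ≤ m)
    (hlt : (setsWithDiffs k (j + 1)).card < (setsWithDiffs k j).card) :
    ∃ m : ℕ, 1 ≤ m ∧
      pR'' (k + 1) (fun S => missDiff S 0 (((k + 1 : ℕ) : ℤ) - 1) = m) >
        pR'' (k + 1) (fun S => missDiff S 0 (((k + 1 : ℕ) : ℤ) - 1) = m - 1) := by
  refine ⟨m, hm1, ?_⟩
  rw [pR''_missDiff_eq hm, pR''_missDiff_eq (j := j + 1) (by omega)]
  gcongr

theorem natDiffs_pair (k : ℕ) : natDiffs {0, k} = {0, k} := by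
  ext d
  simp only [mem_natDiffs, mem_insert, mem_singleton, exists_eq_or_imp, exists_eq_left]
  omega

theorem natDiffs_triple {a k : ℕ} (hak : a ≤ k) : natDiffs {0, a, k} = {0, a, k - a, k} := by
  ext d
  simp only [mem_natDiffs, mem_insert, mem_singleton, exists_eq_or_imp, exists_eq_left]
  omega

theorem card_quadruple {a b c d : ℕ} (hab : a ≠ b) (hac : a ≠ c) (had : a ≠ d) (hbc : b ≠ c)
    (hbd : b ≠ d) (hcd : c ≠ d) : ({a, b, c, d} : Finset ℕ).card = 4 := by
  rw [card_insert_of_notMem (by simp [*]), card_eq_three.2 ⟨b, c, d, hbc, hbd, hcd, rfl⟩]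

theorem exists_mem_ne_endpoints {S : Finset ℕ} {k : ℕ} (h0 : 0 ∈ S) (hk : k ∈ S)
    (hcard : 2 < (natDiffs S).card) : ∃ x ∈ S, x ≠ 0 ∧ x ≠ k := by
  by_contra! hx
  have hS : S = {0, k} := by
    ext x
    simp only [mem_insert, mem_singleton]
    constructor
    · intro h
      by_cases hx0 : x = 0
      · exact Or.inl hx0
      · exact Or.inr (hx x h hx0)
    · rintro (rfl | rfl) <;> assumption
  rw [hS, natDiffs_pair] at hcard
  exact absurd hcard (not_lt.2 card_le_two)

theorem card_setsWithDiffs_three_lt_two {k : ℕ} (hk : k % 2 = 1) :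
    (setsWithDiffs k 3).card < (setsWithDiffs k 2).card := by
  have h3 : setsWithDiffs k 3 = ∅ := by
    refine eq_empty_of_forall_notMem fun S hS => ?_
    obtain ⟨hSk, h0, hkS, hcard⟩ := mem_setsWithDiffs.1 hS
    obtain ⟨x, hx, hx0, hxk⟩ := exists_mem_ne_endpoints h0 hkS (by omega)
    have hxle := mem_range.1 (hSk hx)
    have hsub : ({0, x, k - x, k} : Finset ℕ) ⊆ natDiffs S := by
      simp only [insert_subset_iff, singleton_subset_iff]
      exact ⟨sub_mem_natDiffs h0 h0, sub_mem_natDiffs hx h0, sub_mem_natDiffs hkS hx,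
        sub_mem_natDiffs hkS h0⟩
    have := card_le_card hsub
    rw [card_quadruple (by omega) (by omega) (by omega) (by omega) (by omega) (by omega)] at this
    omega
  rw [h3, card_empty, card_pos]
  refine ⟨{0, k}, mem_setsWithDiffs.2 ⟨?_, by simp, by simp, ?_⟩⟩
  · simp [insert_subset_iff]
  · rw [natDiffs_pair, card_pair (by omega)]

theorem le_card_setsWithDiffs_four (h : ℕ) : 2 * h - 2 ≤ (setsWithDiffs (2 * h) 4).card := by
  have hinj : Set.InjOn (fun a => ({0, a, 2 * h} : Finset ℕ)) ((Finset.Ioo 0 (2 * h)).erase h) := by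
    intro a ha b hb hab
    have ha' : 0 < a ∧ a < 2 * h := by simpa using (mem_erase.1 (mem_coe.1 ha)).2
    have hmem : a ∈ ({0, b, 2 * h} : Finset ℕ) := by
      rw [← show ({0, a, 2 * h} : Finset ℕ) = {0, b, 2 * h} from hab]
      simp
    simp only [mem_insert, mem_singleton] at hmem
    omega
  have hsub : ((Finset.Ioo 0 (2 * h)).erase h).image (fun a => ({0, a, 2 * h} : Finset ℕ)) ⊆
      setsWithDiffs (2 * h) 4 := by
    intro S hS
    obtain ⟨a, ha, rfl⟩ := mem_image.1 hS
    rw [mem_erase, Finset.mem_Ioo] at ha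
    refine mem_setsWithDiffs.2 ⟨?_, by simp, by simp, ?_⟩
    · simp only [insert_subset_iff, singleton_subset_iff, mem_range]
      omega
    · rw [natDiffs_triple (by omega)]
      exact card_quadruple (by omega) (by omega) (by omega) (by omega) (by omega) (by omega)
  have hle := card_le_card hsub
  rw [card_image_of_injOn hinj] at hle
  have herase := pred_card_le_card_erase (s := Finset.Ioo 0 (2 * h)) (a := h)
  rw [Nat.card_Ioo] at herase
  omega

theorem eq_of_natDiffs_card_eq_five {h : ℕ} {S : Finset ℕ} (hS : S ∈ setsWithDiffs (2 * h) 5) :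
    (∃ a ∈ Finset.Ioo 0 h, S = {0, a, 2 * h - a, 2 * h}) ∨
      ∃ q, h = 2 * q ∧ (S = {0, q, 2 * q, 4 * q} ∨ S = {0, 2 * q, 3 * q, 4 * q} ∨
        S = {0, q, 2 * q, 3 * q, 4 * q}) := by
  obtain ⟨hSk, h0, hkS, hcard⟩ := mem_setsWithDiffs.1 hS
  have hle : ∀ x ∈ S, x ≤ 2 * h := fun x hx => Nat.lt_succ_iff.1 (mem_range.1 (hSk hx))
  have hfour : ∀ w ∈ natDiffs S, ∀ x ∈ natDiffs S, ∀ y ∈ natDiffs S, ∀ z ∈ natDiffs S,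
      (0 < w ∧ w < 2 * h) → (0 < x ∧ x < 2 * h) → (0 < y ∧ y < 2 * h) → (0 < z ∧ z < 2 * h) →
      w = x ∨ w = y ∨ w = z ∨ x = y ∨ x = z ∨ y = z := by
    intro w hw x hx y hy z hz hw' hx' hy' hz'
    by_contra! hne
    have hsub : ({0, 2 * h, w, x, y, z} : Finset ℕ) ⊆ natDiffs S := by
      simp only [insert_subset_iff, singleton_subset_iff]
      exact ⟨sub_mem_natDiffs h0 h0, sub_mem_natDiffs hkS h0, hw, hx, hy, hz⟩
    have hc := card_le_card hsub
    rw [card_insert_of_notMem (by simp only [mem_insert, mem_singleton]; omega),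
      card_insert_of_notMem (by simp only [mem_insert, mem_singleton]; omega),
      card_quadruple (by omega) (by omega) (by omega) (by omega) (by omega) (by omega)] at hc
    omega
  obtain ⟨a, ha, ha0, hak⟩ := exists_mem_ne_endpoints h0 hkS (by omega)
  obtain ⟨b, hb, hb0, hbk, hba⟩ : ∃ b ∈ S, b ≠ 0 ∧ b ≠ 2 * h ∧ b ≠ a := by
    by_contra! hx
    have hSa : S = {0, a, 2 * h} := by
      ext x
      simp only [mem_insert, mem_singleton]
      constructor
      · intro h
        have := hx x h
        tauto
      · rintro (rfl | rfl | rfl) <;> assumption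
    rw [hSa, natDiffs_triple (hle a ha)] at hcard
    have := card_le_four (a := 0) (b := a) (c := 2 * h - a) (d := 2 * h)
    omega
  have hpair : ∀ x ∈ S, ∀ y ∈ S, x ≠ 0 → x ≠ 2 * h → y ≠ 0 → y ≠ 2 * h → x ≠ y →
      x = h ∨ y = h ∨ x + y = 2 * h := by
    intro x hx y hy hx0 hxk hy0 hyk hxy
    have hxle := hle x hx
    have hyle := hle y hy
    have := hfour x (sub_mem_natDiffs hx h0) y (sub_mem_natDiffs hy h0)
      (2 * h - x) (sub_mem_natDiffs hkS hx) (2 * h - y) (sub_mem_natDiffs hkS hy)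
      (by omega) (by omega) (by omega) (by omega)
    omega
  have hale := hle a ha
  have hble := hle b hb
  by_cases hh : h ∈ S
  · right
    have hquarter : ∀ c ∈ S, c ≠ 0 → c ≠ 2 * h → c ≠ h → h = 2 * c ∨ 2 * c = 3 * h := by
      intro c hc hc0 hck hch
      have hcle := hle c hc
      rcases lt_or_gt_of_ne hch with hlt | hgt
      · have := hfour c (sub_mem_natDiffs hc h0) h (sub_mem_natDiffs hh h0)
          (2 * h - c) (sub_mem_natDiffs hkS hc) (h - c) (sub_mem_natDiffs hh hc)
          (by omega) (by omega) (by omega) (by omega)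
        omega
      · have := hfour c (sub_mem_natDiffs hc h0) h (sub_mem_natDiffs hh h0)
          (2 * h - c) (sub_mem_natDiffs hkS hc) (c - h) (sub_mem_natDiffs hc hh)
          (by omega) (by omega) (by omega) (by omega)
        omega
    obtain ⟨q, rfl⟩ : ∃ q, h = 2 * q := by
      by_cases hah : a = h
      · have := hquarter b hb hb0 hbk (by omega)
        exact ⟨h / 2, by omega⟩
      · have := hquarter a ha ha0 hak hah
        exact ⟨h / 2, by omega⟩
    refine ⟨q, rfl, ?_⟩
    have hk4 : 4 * q ∈ S := by
      rw [show 4 * q = 2 * (2 * q) by ring]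
      exact hkS
    have hform : ∀ x ∈ S, x = 0 ∨ x = q ∨ x = 2 * q ∨ x = 3 * q ∨ x = 4 * q := by
      intro x hx
      have := hquarter x hx
      omega
    have hor : q ∈ S ∨ 3 * q ∈ S := by
      by_cases hah : a = 2 * q
      · rcases hquarter b hb hb0 hbk (by omega) with hq | hq
        · left; rwa [show q = b by omega]
        · right; rwa [show 3 * q = b by omega]
      · rcases hquarter a ha ha0 hak hah with hq | hq
        · left; rwa [show q = a by omega]
        · right; rwa [show 3 * q = a by omega]
    by_cases hq : q ∈ S
    · by_cases hq3 : 3 * q ∈ S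
      · right; right
        ext x
        simp only [mem_insert, mem_singleton]
        exact ⟨hform x, by rintro (rfl | rfl | rfl | rfl | rfl) <;> assumption⟩
      · left
        ext x
        simp only [mem_insert, mem_singleton]
        constructor
        · intro hx
          have hne : x ≠ 3 * q := fun he => hq3 (he ▸ hx)
          have := hform x hx
          tauto
        · rintro (rfl | rfl | rfl | rfl) <;> assumption
    · have hq3 : 3 * q ∈ S := hor.resolve_left hq
      right; left
      ext x
      simp only [mem_insert, mem_singleton]
      constructor
      · intro hx
        have hne : x ≠ q := fun he => hq (he ▸ hx)
        have := hform x hx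
        tauto
      · rintro (rfl | rfl | rfl | rfl) <;> assumption
  · left
    have hneh : ∀ x ∈ S, x ≠ h := fun x hx he => hh (he ▸ hx)
    have hah := hneh a ha
    have hbh := hneh b hb
    have hab := hpair a ha b hb ha0 hak hb0 hbk hba.symm
    have hform : ∀ x ∈ S, x = 0 ∨ x = a ∨ x = b ∨ x = 2 * h := by
      intro x hx
      have hxh := hneh x hx
      have := hpair x hx a ha
      have := hpair x hx b hb
      omega
    have hSab : S = {0, a, b, 2 * h} := by
      ext x
      simp only [mem_insert, mem_singleton]
      exact ⟨hform x, by rintro (rfl | rfl | rfl | rfl) <;> assumption⟩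
    rcases lt_or_gt_of_ne hah with hlt | hgt
    · exact ⟨a, by rw [Finset.mem_Ioo]; omega, by rw [hSab, show 2 * h - a = b by omega]⟩
    · refine ⟨b, by rw [Finset.mem_Ioo]; omega, ?_⟩
      rw [hSab, show 2 * h - b = a by omega]
      ext x
      simp only [mem_insert, mem_singleton]
      tauto

theorem card_setsWithDiffs_five_lt_four {h : ℕ} (h3 : 3 ≤ h) (h4 : h ≠ 4) :
    (setsWithDiffs (2 * h) 5).card < (setsWithDiffs (2 * h) 4).card := by
  have hlow := le_card_setsWithDiffs_four h
  set A := (Finset.Ioo 0 h).image fun a => ({0, a, 2 * h - a, 2 * h} : Finset ℕ) with hA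
  have hAcard : A.card ≤ h - 1 := by
    simpa using card_image_le (s := Finset.Ioo 0 h)
      (f := fun a => ({0, a, 2 * h - a, 2 * h} : Finset ℕ))
  have hmemA : ∀ S : Finset ℕ, (∃ a ∈ Finset.Ioo 0 h, S = {0, a, 2 * h - a, 2 * h}) → S ∈ A := by
    rintro S ⟨a, ha, rfl⟩
    exact mem_image_of_mem _ ha
  rcases Nat.even_or_odd' h with ⟨q, hq | hq⟩
  · have hsub : setsWithDiffs (2 * h) 5 ⊆ A ∪ {{0, q, 2 * q, 4 * q}, {0, 2 * q, 3 * q, 4 * q},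
        {0, q, 2 * q, 3 * q, 4 * q}} := by
      intro S hS
      rw [mem_union]
      rcases eq_of_natDiffs_card_eq_five hS with ha | ⟨r, hr, hS'⟩
      · exact Or.inl (hmemA S ha)
      · obtain rfl : r = q := by omega
        right
        simpa only [mem_insert, mem_singleton] using hS'
    have hc := (card_le_card hsub).trans (card_union_le _ _)
    have := card_le_three (a := ({0, q, 2 * q, 4 * q} : Finset ℕ)) (b := {0, 2 * q, 3 * q, 4 * q})
      (c := {0, q, 2 * q, 3 * q, 4 * q})
    omega
  · have hsub : setsWithDiffs (2 * h) 5 ⊆ A := by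
      intro S hS
      rcases eq_of_natDiffs_card_eq_five hS with ha | ⟨r, hr, -⟩
      · exact hmemA S ha
      · omega
    have := card_le_card hsub
    omega

/-- For every integer `n ≥ 2` outside `{2, 3, 5, 9}`, the function
`m ↦ P(f⁻_{[0,n-1]}(R_n'') = m)` is not nonincreasing: there is some `m ≥ 1` with
`P(f⁻_{[0,n-1]}(R_n'') = m) > P(f⁻_{[0,n-1]}(R_n'') = m - 1)`. -/
theorem missing_diffs_not_decreasing (n : ℕ) (hn : 2 ≤ n) (h : n ∉ ({2, 3, 5, 9} : Set ℕ)) :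
    ∃ m : ℕ, 1 ≤ m ∧
      pR'' n (fun S => missDiff S 0 ((n : ℤ) - 1) = m) >
        pR'' n (fun S => missDiff S 0 ((n : ℤ) - 1) = m - 1) := by
  simp only [Set.mem_insert_iff, Set.mem_singleton_iff, not_or] at h
  obtain ⟨h2, h3, h5, h9⟩ := h
  obtain ⟨k, rfl⟩ : ∃ k, n = k + 1 := ⟨n - 1, by omega⟩
  rcases Nat.even_or_odd' k with ⟨r, rfl | rfl⟩
  · exact exists_increase_of_card_lt (j := 4) (m := 2 * r - 3) (by omega) (by omega)
      (card_setsWithDiffs_five_lt_four (by omega) (by omega))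
  · exact exists_increase_of_card_lt (j := 2) (m := 2 * r) (by omega) (by omega)
      (card_setsWithDiffs_three_lt_two (by omega))
end
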